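/- arXiv:2303.10919 — 4 statements merged into one kernel-verified Lean document; each statement's English description precedes it below -/
import Mathlib

section
/- Suppose λ_1 < ... < λ_N are real numbers with |λ_k − λ_ℓ| ≥ |k − ℓ| for all k, ℓ, and a_1, ..., a_N are complex numbers. Then for every T ≥ 72, (1/T) ∫_{-T/2}^{T/2} |∑_{k=1}^N a_k e^{2πi λ_k t}| dt ≥ (1/122) ∑_{k=1}^N |a_k|/(k+1). -/
open MeasureTheory intervalIntegral

/-- The character `s ↦ exp (2πi x s)`. -/
noncomputable def wave (x s : ℝ) : ℂ := Complex.exp (((2 * Real.pi * x * s : ℝ) : ℂ) * Complex.I)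

/-- The Hann window on `[-1/2, 1/2]`. -/
noncomputable def hann (s : ℝ) : ℝ := (1 + Real.cos (2 * Real.pi * s)) / 2

lemma continuous_wave (x : ℝ) : Continuous (wave x) := by
  unfold wave; fun_prop

lemma continuous_hann : Continuous hann := by
  unfold hann; fun_prop

lemma hann_nonneg (s : ℝ) : 0 ≤ hann s := by
  unfold hann; linarith [Real.neg_one_le_cos (2 * Real.pi * s)]

lemma hann_le_one (s : ℝ) : hann s ≤ 1 := by
  unfold hann; linarith [Real.cos_le_one (2 * Real.pi * s)]

lemma norm_wave (x s : ℝ) : ‖wave x s‖ = 1 := Complex.norm_exp_ofReal_mul_I _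

lemma wave_zero (s : ℝ) : wave 0 s = 1 := by simp [wave]

lemma wave_add (x y s : ℝ) : wave (x + y) s = wave x s * wave y s := by
  unfold wave; rw [← Complex.exp_add]; push_cast; ring_nf

lemma conj_wave (x s : ℝ) : (starRingEnd ℂ) (wave x s) = wave (-x) s := by
  unfold wave; rw [← Complex.exp_conj, map_mul, Complex.conj_ofReal, Complex.conj_I]
  push_cast; ring_nf

lemma wave_natCast (n : ℕ) (s : ℝ) : wave n s = wave 1 s ^ n := by
  unfold wave; rw [← Complex.exp_nat_mul]; push_cast; ring_nf

lemma integral_wave {x : ℝ} (hx : x ≠ 0) :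
    ∫ s in (-(1/2 : ℝ))..(1/2), wave x s = ((Real.sin (Real.pi * x) / (Real.pi * x) : ℝ) : ℂ) := by
  have hc : (2 * Real.pi * x * Complex.I : ℂ) ≠ 0 := by
    simp [hx, Real.pi_ne_zero]
  have h := integral_exp_mul_complex (a := -(1/2)) (b := 1/2) hc
  have hpi : (Real.pi : ℂ) ≠ 0 := by exact_mod_cast Real.pi_ne_zero
  have hxc : (x : ℂ) ≠ 0 := by exact_mod_cast hx
  calc _ = ∫ s in (-(1/2 : ℝ))..(1/2), Complex.exp (2 * Real.pi * x * Complex.I * s) := by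
        congr 1; ext s; unfold wave; push_cast; ring_nf
    _ = _ := by
        rw [h]; push_cast; rw [Complex.sin]
        have h1 : (2 * Real.pi * x * Complex.I * (1 / 2) : ℂ) = Real.pi * x * Complex.I := by ring
        have h2 : (2 * Real.pi * x * Complex.I * -(1 / 2) : ℂ) = -(Real.pi * x) * Complex.I := by ring
        rw [h1, h2]; field_simp; simp only [Complex.I_sq]; ring

lemma hann_eq_wave (s : ℝ) : (hann s : ℂ) = 1 / 2 + wave 1 s / 4 + wave (-1) s / 4 := by
  unfold hann wave; push_cast; rw [Complex.cos]; ring_nf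

lemma integral_hann_mul_wave_zero :
    ∫ s in (-(1/2 : ℝ))..(1/2), (hann s : ℂ) * wave 0 s = 1 / 2 := by
  have e : ∀ s, (hann s : ℂ) * wave 0 s = 1 / 2 + wave 1 s / 4 + wave (-1) s / 4 := fun s => by
    rw [hann_eq_wave, wave_zero, mul_one]
  have i1 := (continuous_wave 1).div_const 4
  have i2 := (continuous_wave (-1)).div_const 4
  simp_rw [e]
  rw [intervalIntegral.integral_add, intervalIntegral.integral_add, intervalIntegral.integral_div, intervalIntegral.integral_div,
    integral_wave one_ne_zero, intervalIntegral.integral_div, integral_wave (by norm_num)]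
  · simp
  all_goals exact Continuous.intervalIntegrable (by fun_prop) _ _

lemma norm_integral_hann_mul_wave_le {x : ℝ} (hx : 1 < |x|) :
    ‖∫ s in (-(1/2 : ℝ))..(1/2), (hann s : ℂ) * wave x s‖ ≤ 1 / (|x| * (x ^ 2 - 1)) := by
  have hx0 : x ≠ 0 := by rintro rfl; norm_num at hx
  have hx2 : 1 < x ^ 2 := by rw [← sq_abs]; nlinarith
  have hx1 : x + 1 ≠ 0 := fun h => by nlinarith
  have hx1' : x + -1 ≠ 0 := fun h => by nlinarith
  have e : ∀ s, (hann s : ℂ) * wave x s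
      = wave x s / 2 + wave (x + 1) s / 4 + wave (x + -1) s / 4 := fun s => by
    rw [hann_eq_wave, wave_add, wave_add]; ring
  have i0 := (continuous_wave x).div_const 2
  have i1 := (continuous_wave (x + 1)).div_const 4
  have i2 := (continuous_wave (x + -1)).div_const 4
  simp_rw [e]
  rw [intervalIntegral.integral_add, intervalIntegral.integral_add, intervalIntegral.integral_div, intervalIntegral.integral_div,
    intervalIntegral.integral_div,
    integral_wave hx0, integral_wave hx1, integral_wave hx1']
  · have s1 : Real.sin (Real.pi * (x + 1)) = - Real.sin (Real.pi * x) := by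
      rw [mul_add, mul_one, Real.sin_add_pi]
    have s2 : Real.sin (Real.pi * (x + -1)) = - Real.sin (Real.pi * x) := by
      rw [mul_add, mul_neg_one, ← sub_eq_add_neg, Real.sin_sub_pi]
    rw [s1, s2]
    have key : Real.sin (Real.pi * x) / (Real.pi * x) / 2
        + -Real.sin (Real.pi * x) / (Real.pi * (x + 1)) / 4
        + -Real.sin (Real.pi * x) / (Real.pi * (x + -1)) / 4
        = - (Real.sin (Real.pi * x) / (2 * Real.pi)) * (1 / (x * (x ^ 2 - 1))) := by
      have h3 : x ^ 2 - 1 = (x + 1) * (x + -1) := by ring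
      rw [h3]; field_simp; ring
    have key2 := congrArg (fun r : ℝ => (r : ℂ)) key
    push_cast at key2 ⊢
    rw [key2, norm_mul, norm_neg]
    have n1 : ‖(1 / (x * (x ^ 2 - 1)) : ℂ)‖ = 1 / (|x| * (x ^ 2 - 1)) := by
      rw [← abs_of_pos (sub_pos.2 hx2), ← abs_mul, ← abs_one_div, ← Real.norm_eq_abs, ← Complex.norm_real]
      push_cast; rfl
    rw [n1]
    have n2 : ‖(Complex.sin (Real.pi * x) / (2 * Real.pi) : ℂ)‖ ≤ 1 := by
      have : (Complex.sin (Real.pi * x) / (2 * Real.pi) : ℂ)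
          = ((Real.sin (Real.pi * x) / (2 * Real.pi) : ℝ) : ℂ) := by push_cast; rfl
      rw [this, Complex.norm_real, Real.norm_eq_abs, abs_div, abs_of_pos Real.two_pi_pos,
        div_le_one Real.two_pi_pos]
      linarith [Real.abs_sin_le_one (Real.pi * x), Real.pi_gt_three]
    have : 0 ≤ 1 / (|x| * (x ^ 2 - 1)) := by
      have := sub_pos.2 hx2; positivity
    nlinarith
  all_goals exact Continuous.intervalIntegrable (by fun_prop) _ _

lemma integral_weighted_norm_sq {ι : Type*} (A : Finset ι) (c : ι → ℂ) (x : ι → ℝ) {w : ℝ → ℝ}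
    (hw : Continuous w) :
    ((∫ s in (-(1/2 : ℝ))..(1/2), w s * ‖∑ i ∈ A, c i * wave (x i) s‖ ^ 2 : ℝ) : ℂ)
      = ∑ i ∈ A, ∑ j ∈ A, c i * (starRingEnd ℂ) (c j) *
          ∫ s in (-(1/2 : ℝ))..(1/2), (w s : ℂ) * wave (x i - x j) s := by
  have cw : ∀ y, Continuous (wave y) := continuous_wave
  rw [← intervalIntegral.integral_ofReal]
  simp_rw [← intervalIntegral.integral_const_mul]
  rw [← Finset.sum_congr rfl fun i _ => intervalIntegral.integral_finsetSum
    (fun j _ => Continuous.intervalIntegrable (by fun_prop) _ _),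
    ← intervalIntegral.integral_finsetSum
    (fun i _ => Continuous.intervalIntegrable (by fun_prop) _ _)]
  congr 1; ext s
  push_cast
  rw [← Complex.mul_conj', map_sum, Finset.sum_mul_sum, Finset.mul_sum]
  refine Finset.sum_congr rfl fun i _ => ?_
  rw [Finset.mul_sum]
  refine Finset.sum_congr rfl fun j _ => ?_
  rw [map_mul, conj_wave, sub_eq_add_neg, wave_add]; ring

lemma norm_exp_neg_sub_one_le {z : ℂ} (hz : 0 ≤ z.re) : ‖Complex.exp (-z) - 1‖ ≤ ‖z‖ := by
  have hconv : Convex ℝ {w : ℂ | w.re ≤ 0} := convex_halfSpace_re_le 0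
  have h := hconv.norm_image_sub_le_of_norm_deriv_le (f := Complex.exp) (C := 1) (x := 0) (y := -z)
    (fun w _ => Complex.differentiable_exp w) (fun w hw => by
      rw [Complex.deriv_exp, Complex.norm_exp]
      exact Real.exp_le_one_iff.2 hw) (by simp) (by simpa using hz)
  simpa using h

lemma exists_wave_eq {z : ℂ} (hz : ‖z‖ = 1) : ∃ s ∈ Set.Icc (-(1/2) : ℝ) (1/2), wave 1 s = z := by
  have hpi := Real.pi_pos
  have h1 := Complex.arg_le_pi z
  have h2 := Complex.neg_pi_lt_arg z
  refine ⟨z.arg / (2 * Real.pi), ⟨?_, ?_⟩, ?_⟩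
  · rw [le_div_iff₀ (by positivity)]; linarith
  · rw [div_le_iff₀ (by positivity)]; linarith
  · have h := Complex.norm_mul_exp_arg_mul_I z
    rw [hz] at h
    have e : 2 * Real.pi * 1 * (z.arg / (2 * Real.pi)) = z.arg := by field_simp
    unfold wave; rw [e]; simpa using h

lemma sum_range_one_div_le {x : ℝ} (hx : 1 < x) (n : ℕ) :
    ∑ i ∈ Finset.range n, 1 / ((x + i) * ((x + i) ^ 2 - 1)) ≤ 1 / (2 * x * (x - 1)) := by
  have key : ∀ i ∈ Finset.range n, 1 / ((x + i) * ((x + i) ^ 2 - 1))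
      = 1 / (2 * (x + (i : ℕ)) * (x + (i : ℕ) - 1))
        - 1 / (2 * (x + ((i + 1 : ℕ) : ℝ)) * (x + ((i + 1 : ℕ) : ℝ) - 1)) := by
    intro i _
    have hi : (0 : ℝ) ≤ i := i.cast_nonneg
    have h1 : x + i ≠ 0 := by positivity
    have h2 : x + i - 1 ≠ 0 := by intro h; linarith
    have h3 : x + i + 1 ≠ 0 := by positivity
    push_cast
    have e1 : (x + i) ^ 2 - 1 = (x + i - 1) * (x + i + 1) := by ring
    have e2 : x + ((i : ℝ) + 1) - 1 = x + i := by ring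
    have e3 : x + ((i : ℝ) + 1) = x + i + 1 := by ring
    rw [e1, e2, e3]; field_simp; ring
  rw [Finset.sum_congr rfl key,
    Finset.sum_range_sub' (fun i : ℕ => 1 / (2 * (x + (i : ℝ)) * (x + (i : ℝ) - 1)))]
  have hn : (0 : ℝ) ≤ n := n.cast_nonneg
  have : 0 ≤ 1 / (2 * (x + (n : ℝ)) * (x + (n : ℝ) - 1)) := by
    have : 0 < x + n - 1 := by linarith
    positivity
  simp only [Nat.cast_zero, add_zero]; linarith

/-- Against a bounded analytic factor, the Hann window still filters out the frequency `x`. -/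
lemma norm_integral_hann_mul_wave_mul_analytic_le {E : ℂ → ℂ} (hE : Differentiable ℂ E)
    (hb : ∀ s ∈ Set.Icc (-(1/2) : ℝ) (1/2), ‖E (wave 1 s)‖ ≤ 1) {x : ℝ} (hx : 1 < x) :
    ‖∫ s in (-(1/2 : ℝ))..(1/2), (hann s : ℂ) * wave x s * E (wave 1 s)‖
      ≤ 1 / (2 * x * (x - 1)) := by
  set g : ℕ → ℂ := fun n => (n.factorial : ℂ)⁻¹ * iteratedDeriv n E 0 with hg
  have hsum : ∀ z, HasSum (fun n => g n * z ^ n) (E z) := fun z => by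
    have h := Complex.hasSum_taylorSeries_of_entire hE 0 z
    have e : (fun n : ℕ => (n.factorial : ℂ)⁻¹ • (z - 0) ^ n • iteratedDeriv n E 0)
        = fun n => g n * z ^ n := by
      ext n; simp only [hg, sub_zero, smul_eq_mul]; ring
    exact e ▸ h
  have hgb : ∀ n, ‖g n‖ ≤ 1 := fun n => by
    have := Complex.norm_iteratedDeriv_le_of_forall_mem_sphere_norm_le (c := 0) (R := 1) (C := 1) n
      one_pos hE.diffContOnCl (fun z hz => by
        obtain ⟨s, hs, rfl⟩ := exists_wave_eq (z := z) (by simpa using hz)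
        exact hb s hs)
    rw [hg]; simp only [norm_mul, norm_inv, Complex.norm_natCast]
    rw [inv_mul_le_iff₀ (by positivity)]
    simpa using this
  have hgs : Summable (fun n => ‖g n‖) := by
    simpa using (hsum 1).summable.norm
  have cw := continuous_wave
  have ch := continuous_hann
  have hsum_int := intervalIntegral.hasSum_integral_of_dominated_convergence (μ := volume)
    (a := -(1/2 : ℝ)) (b := 1/2)
    (F := fun (n : ℕ) s => (hann s : ℂ) * wave x s * (g n * wave 1 s ^ n))
    (f := fun s => (hann s : ℂ) * wave x s * E (wave 1 s)) (fun n _ => ‖g n‖)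
    (fun n => (by fun_prop : Continuous _).aestronglyMeasurable)
    (fun n => Filter.Eventually.of_forall fun s _ => by
      simp only [norm_mul, norm_pow, norm_wave, one_pow, mul_one]
      rw [Complex.norm_real, Real.norm_of_nonneg (hann_nonneg s)]
      exact mul_le_of_le_one_left (norm_nonneg _) (hann_le_one s))
    (Filter.Eventually.of_forall fun s _ => hgs)
    (by simp)
    (Filter.Eventually.of_forall fun s _ => (hsum (wave 1 s)).mul_left _)
  refine le_of_tendsto' hsum_int.tendsto_sum_nat.norm fun n => ?_
  refine (norm_sum_le _ _).trans (le_trans (Finset.sum_le_sum fun i _ => ?_)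
    (sum_range_one_div_le hx n))
  have hi : (0 : ℝ) ≤ i := i.cast_nonneg
  have e : ∀ s, (hann s : ℂ) * wave x s * (g i * wave 1 s ^ i)
      = g i * ((hann s : ℂ) * wave (x + i) s) := fun s => by
    rw [wave_add, wave_natCast]; ring
  simp_rw [e]
  rw [intervalIntegral.integral_const_mul, norm_mul]
  have habs : |x + i| = x + i := abs_of_pos (by linarith)
  have := norm_integral_hann_mul_wave_le (x := x + i) (by rw [habs]; linarith)
  rw [habs] at this
  exact (mul_le_of_le_one_left (norm_nonneg _) (hgb i)).trans this

lemma integral_mul_le_of_sq_le {f g : ℝ → ℝ} (hf : Continuous f) (hg : Continuous g) {A B : ℝ}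
    (hA : 0 < A) (hB : 0 < B) (hfA : ∫ s in (-(1/2 : ℝ))..(1/2), f s ^ 2 ≤ A ^ 2)
    (hgB : ∫ s in (-(1/2 : ℝ))..(1/2), g s ^ 2 ≤ B ^ 2) :
    ∫ s in (-(1/2 : ℝ))..(1/2), f s * g s ≤ A * B := by
  have h1 : ∫ s in (-(1/2 : ℝ))..(1/2), f s * g s
      ≤ ∫ s in (-(1/2 : ℝ))..(1/2), (B / (2 * A) * f s ^ 2 + A / (2 * B) * g s ^ 2) := by
    refine intervalIntegral.integral_mono (by norm_num)
      (Continuous.intervalIntegrable (by fun_prop) _ _)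
      (Continuous.intervalIntegrable (by fun_prop) _ _) fun s => ?_
    have e : B / (2 * A) * f s ^ 2 + A / (2 * B) * g s ^ 2 - f s * g s
        = (B * f s - A * g s) ^ 2 / (2 * A * B) := by field_simp; ring
    have : 0 ≤ (B * f s - A * g s) ^ 2 / (2 * A * B) := by positivity
    change f s * g s ≤ B / (2 * A) * f s ^ 2 + A / (2 * B) * g s ^ 2
    linarith
  rw [intervalIntegral.integral_add (Continuous.intervalIntegrable (by fun_prop) _ _)
    (Continuous.intervalIntegrable (by fun_prop) _ _), intervalIntegral.integral_const_mul,
    intervalIntegral.integral_const_mul] at h1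
  have h2 : B / (2 * A) * ∫ s in (-(1/2 : ℝ))..(1/2), f s ^ 2 ≤ B / (2 * A) * A ^ 2 := by gcongr
  have h3 : A / (2 * B) * ∫ s in (-(1/2 : ℝ))..(1/2), g s ^ 2 ≤ A / (2 * B) * B ^ 2 := by gcongr
  have e : B / (2 * A) * A ^ 2 + A / (2 * B) * B ^ 2 = A * B := by field_simp; ring
  linarith

lemma exists_trigPoly_approx {u : ℝ → ℝ} (hu : Continuous u) (hper : u (-(1/2)) = u (1/2))
    {δ : ℝ} (hδ : 0 < δ) : ∃ (A : Finset ℤ) (c : ℤ → ℂ), ∀ s ∈ Set.Icc (-(1/2) : ℝ) (1/2),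
      ‖∑ n ∈ A, c n * wave n s - u s‖ < δ := by
  have : Fact ((0 : ℝ) < 1) := ⟨one_pos⟩
  have hper' : (fun s : ℝ => (u s : ℂ)) (-(1/2)) = (fun s : ℝ => (u s : ℂ)) (-(1/2) + 1) := by
    have : (-(1/2) + 1 : ℝ) = 1/2 := by norm_num
    simp only [this, hper]
  let f : C(AddCircle (1 : ℝ), ℂ) :=
    ⟨AddCircle.liftIco 1 (-(1/2)) (fun s => (u s : ℂ)),
      AddCircle.liftIco_continuous hper' (by fun_prop)⟩
  have hf : ∀ s ∈ Set.Icc (-(1/2) : ℝ) (1/2), f (s : AddCircle (1 : ℝ)) = u s := by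
    intro s hs
    rcases eq_or_lt_of_le hs.2 with h | h
    · have e : ((s : ℝ) : AddCircle (1 : ℝ)) = ((-(1/2) : ℝ) : AddCircle (1 : ℝ)) := by
        rw [h, ← AddCircle.coe_add_period (1 : ℝ) (-(1/2))]; norm_num
      rw [e]
      change AddCircle.liftIco 1 (-(1/2)) (fun s => (u s : ℂ)) _ = _
      rw [AddCircle.liftIco_coe_apply ⟨le_refl _, by norm_num⟩, hper, h]
    · change AddCircle.liftIco 1 (-(1/2)) (fun s => (u s : ℂ)) _ = _
      rw [AddCircle.liftIco_coe_apply ⟨hs.1, by linarith⟩]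
  have hmem : f ∈ closure (Submodule.span ℂ (Set.range (@fourier (1 : ℝ))) : Set _) := by
    have := span_fourier_closure_eq_top (T := 1)
    rw [← Submodule.topologicalClosure_coe, this]; trivial
  obtain ⟨p, hp, hpf⟩ := Metric.mem_closure_iff.1 hmem δ hδ
  obtain ⟨c, rfl⟩ := Finsupp.mem_span_range_iff_exists_finsupp.1 hp
  refine ⟨c.support, c, fun s hs => ?_⟩
  rw [dist_comm, dist_eq_norm] at hpf
  have h := (ContinuousMap.norm_coe_le_norm _ (s : AddCircle (1 : ℝ))).trans_lt hpf
  refine lt_of_eq_of_lt (congrArg norm ?_) h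
  rw [ContinuousMap.sub_apply, hf s hs, Finsupp.sum, ContinuousMap.sum_apply]
  congr 1
  refine Finset.sum_congr rfl fun n _ => ?_
  rw [ContinuousMap.smul_apply, fourier_coe_apply, smul_eq_mul, wave]
  push_cast; congr 2; ring

lemma integral_norm_sq_trigPoly {ι : Type*} (A : Finset ι) (c : ι → ℂ) (ν : ι → ℤ)
    (hν : Set.InjOn ν A) :
    ∫ s in (-(1/2 : ℝ))..(1/2), ‖∑ n ∈ A, c n * wave (ν n) s‖ ^ 2 = ∑ n ∈ A, ‖c n‖ ^ 2 := by
  classical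
  have h := integral_weighted_norm_sq A c (fun n => (ν n : ℝ)) (w := fun _ => 1) continuous_const
  simp only [one_mul, Complex.ofReal_one] at h
  have hdiag : ∀ n ∈ A, ∀ m ∈ A, c n * (starRingEnd ℂ) (c m) *
      (∫ s in (-(1/2 : ℝ))..(1/2), wave ((ν n : ℝ) - ν m) s)
      = if n = m then ((‖c n‖ ^ 2 : ℝ) : ℂ) else 0 := by
    intro n hn m hm
    split_ifs with e
    · subst e
      simp only [sub_self, wave_zero, Complex.mul_conj']
      norm_num
    · have hne : ν n - ν m ≠ 0 := fun h0 => e (hν hn hm (sub_eq_zero.1 h0))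
      have hne' : ((ν n : ℝ) - ν m) ≠ 0 := by exact_mod_cast hne
      rw [integral_wave hne', mul_comm Real.pi, ← Int.cast_sub, Real.sin_int_mul_pi]
      simp
  rw [Finset.sum_congr rfl fun n hn => Finset.sum_congr rfl fun m hm => hdiag n hn m hm] at h
  simp only [Finset.sum_ite_eq] at h
  rw [Finset.sum_congr rfl fun n hn => if_pos hn] at h
  exact_mod_cast h

lemma norm_add_sq_le_weighted {E : Type*} [SeminormedAddCommGroup E] (x y : E) :
    ‖x + y‖ ^ 2 ≤ 6 / 5 * ‖x‖ ^ 2 + 6 * ‖y‖ ^ 2 := by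
  have h := norm_add_le x y
  have h0 := norm_nonneg (x + y)
  nlinarith [sq_nonneg (‖x‖ - 5 * ‖y‖), mul_self_le_mul_self h0 h]

lemma norm_add_sq_le_two {E : Type*} [SeminormedAddCommGroup E] (x y : E) :
    ‖x + y‖ ^ 2 ≤ 2 * ‖x‖ ^ 2 + 2 * ‖y‖ ^ 2 := by
  have h := norm_add_le x y
  have h0 := norm_nonneg (x + y)
  nlinarith [sq_nonneg (‖x‖ - ‖y‖), mul_self_le_mul_self h0 h]

lemma wave_neg_one_pow_conj (n : ℤ) (hn : n < 0) (c : ℂ) (s : ℝ) :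
    ((starRingEnd ℂ) c * wave 1 s ^ n.natAbs).re = (c * wave n s).re := by
  rw [← Complex.conj_re (c * wave n s), map_mul, conj_wave, ← wave_natCast]
  have : ((n.natAbs : ℕ) : ℝ) = -(n : ℝ) := by
    rw [Nat.cast_natAbs, abs_of_neg hn, Int.cast_neg]
  rw [this]

/-- A periodic real function on the unit interval is dominated by the real part of an entire
function of `exp (2πi s)` whose `L²` norm is at most twice as large. -/
lemma exists_entire_majorant {u : ℝ → ℝ} (hu : Continuous u) (hper : u (-(1/2)) = u (1/2))
    {A : ℝ} (hA : 0 < A) (huA : ∫ s in (-(1/2 : ℝ))..(1/2), u s ^ 2 ≤ A ^ 2) :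
    ∃ P : ℂ → ℂ, Differentiable ℂ P ∧
      (∀ s ∈ Set.Icc (-(1/2) : ℝ) (1/2), u s ≤ (P (wave 1 s)).re) ∧
      ∫ s in (-(1/2 : ℝ))..(1/2), ‖P (wave 1 s)‖ ^ 2 ≤ (2 * A) ^ 2 := by
  obtain ⟨S, c, hc⟩ := exists_trigPoly_approx hu hper (δ := A / 5) (by positivity)
  have cw := continuous_wave
  set S₁ := S.filter (fun n => 0 ≤ n)
  set S₂ := S.filter (fun n => ¬ 0 ≤ n)
  set P₁ : ℂ → ℂ := fun z => ∑ n ∈ S₁, c n * z ^ n.natAbs with hP₁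
  set P₂ : ℂ → ℂ := fun z => ∑ n ∈ S₂, (starRingEnd ℂ) (c n) * z ^ n.natAbs with hP₂
  have c₁ : Continuous P₁ := by fun_prop
  have c₂ : Continuous P₂ := by fun_prop
  have i₁ : ∫ s in (-(1/2 : ℝ))..(1/2), ‖P₁ (wave 1 s)‖ ^ 2 = ∑ n ∈ S₁, ‖c n‖ ^ 2 := by
    rw [← integral_norm_sq_trigPoly S₁ c (fun n => ((n.natAbs : ℕ) : ℤ)) (by
      intro n hn m hm h
      have := (Finset.mem_filter.1 hn).2
      have := (Finset.mem_filter.1 hm).2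
      simp only at h; omega)]
    simp only [hP₁, Int.cast_natCast, wave_natCast]
  have i₂ : ∫ s in (-(1/2 : ℝ))..(1/2), ‖P₂ (wave 1 s)‖ ^ 2 = ∑ n ∈ S₂, ‖c n‖ ^ 2 := by
    have := integral_norm_sq_trigPoly S₂ (fun n => (starRingEnd ℂ) (c n))
      (fun n => ((n.natAbs : ℕ) : ℤ)) (by
        intro n hn m hm h
        have := (Finset.mem_filter.1 hn).2
        have := (Finset.mem_filter.1 hm).2
        simp only at h; omega)
    simp only [RCLike.norm_conj] at this
    rw [← this]
    simp only [hP₂, Int.cast_natCast, wave_natCast]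
  have i₀ := integral_norm_sq_trigPoly S c id Function.injective_id.injOn
  simp only [id] at i₀
  have isum : ∑ n ∈ S₁, ‖c n‖ ^ 2 + ∑ n ∈ S₂, ‖c n‖ ^ 2 = ∑ n ∈ S, ‖c n‖ ^ 2 :=
    Finset.sum_filter_add_sum_filter_not _ _ _
  have hre : ∀ s, (P₁ (wave 1 s) + P₂ (wave 1 s)).re = (∑ n ∈ S, c n * wave n s).re := by
    intro s
    rw [← Finset.sum_filter_add_sum_filter_not S (fun n => 0 ≤ n), Complex.add_re, Complex.add_re]
    congr 1
    · congr 1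
      refine Finset.sum_congr rfl fun n hn => ?_
      have h := (Finset.mem_filter.1 hn).2
      have : ((n.natAbs : ℕ) : ℝ) = (n : ℝ) := by
        rw [Nat.cast_natAbs, abs_of_nonneg h]
      rw [← this, wave_natCast]
    · simp only [hP₂, Complex.re_sum]
      exact Finset.sum_congr rfl fun n hn =>
        wave_neg_one_pow_conj n (not_le.1 (Finset.mem_filter.1 hn).2) _ _
  have hIcc : ∀ s ∈ Set.Icc (-(1/2 : ℝ)) (1/2), ‖∑ n ∈ S, c n * wave n s‖ ^ 2
      ≤ 6 / 5 * u s ^ 2 + 6 * (A / 5) ^ 2 := fun s hs => by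
    have h := norm_add_sq_le_weighted ((u s : ℂ)) (∑ n ∈ S, c n * wave n s - u s)
    rw [add_sub_cancel, Complex.norm_real, Real.norm_eq_abs, sq_abs] at h
    have h2 : ‖∑ n ∈ S, c n * wave n s - u s‖ ^ 2 ≤ (A / 5) ^ 2 := by
      gcongr; exact (hc s hs).le
    linarith
  have hS : ∑ n ∈ S, ‖c n‖ ^ 2 ≤ 6 / 5 * A ^ 2 + 6 * (A / 5) ^ 2 := by
    rw [← i₀]
    refine (intervalIntegral.integral_mono_on (by norm_num)
      (Continuous.intervalIntegrable (by fun_prop) _ _)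
      (Continuous.intervalIntegrable (by fun_prop) _ _) hIcc).trans ?_
    rw [intervalIntegral.integral_add (Continuous.intervalIntegrable (by fun_prop) _ _)
      (Continuous.intervalIntegrable (by fun_prop) _ _), intervalIntegral.integral_const_mul,
      intervalIntegral.integral_const]
    norm_num; linarith
  refine ⟨fun z => P₁ z + P₂ z + ((A / 5 : ℝ) : ℂ), ?_, fun s hs => ?_, ?_⟩
  · fun_prop
  · rw [Complex.add_re, hre, Complex.ofReal_re]
    have h := (Complex.abs_re_le_norm _).trans (hc s hs).le
    rw [Complex.sub_re, Complex.ofReal_re, abs_le] at h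
    linarith
  · have hb : ∀ s, ‖P₁ (wave 1 s) + P₂ (wave 1 s) + ((A / 5 : ℝ) : ℂ)‖ ^ 2
        ≤ 12 / 5 * ‖P₁ (wave 1 s)‖ ^ 2 + 12 / 5 * ‖P₂ (wave 1 s)‖ ^ 2 + 6 * (A / 5) ^ 2 := by
      intro s
      have h := norm_add_sq_le_weighted (P₁ (wave 1 s) + P₂ (wave 1 s)) ((A / 5 : ℝ) : ℂ)
      have h2 := norm_add_sq_le_two (P₁ (wave 1 s)) (P₂ (wave 1 s))
      rw [Complex.norm_real, Real.norm_eq_abs, sq_abs] at h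
      linarith
    refine (intervalIntegral.integral_mono (by norm_num)
      (Continuous.intervalIntegrable (by fun_prop) _ _)
      (Continuous.intervalIntegrable (by fun_prop) _ _) hb).trans ?_
    rw [intervalIntegral.integral_add (Continuous.intervalIntegrable (by fun_prop) _ _)
      (Continuous.intervalIntegrable (by fun_prop) _ _), intervalIntegral.integral_add
      (Continuous.intervalIntegrable (by fun_prop) _ _)
      (Continuous.intervalIntegrable (by fun_prop) _ _), intervalIntegral.integral_const_mul,
      intervalIntegral.integral_const_mul, intervalIntegral.integral_const, i₁, i₂]
    norm_num
    nlinarith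

/-- The index of the block of `m` when `ℕ` is cut into consecutive blocks of sizes
`1, 4, 16, …`. -/
def block (m : ℕ) : ℕ := Nat.log 4 (3 * m + 1)

lemma pow_block_le (m : ℕ) : 4 ^ block m ≤ 3 * m + 1 := Nat.pow_log_le_self 4 (by omega)

lemma lt_pow_block (m : ℕ) : 3 * m + 1 < 4 * 4 ^ block m := by
  have := Nat.lt_pow_succ_log_self (b := 4) (by norm_num) (3 * m + 1)
  rw [pow_succ] at this
  unfold block; omega

lemma block_mono {k m : ℕ} (h : k ≤ m) : block k ≤ block m := Nat.log_mono_right (by omega)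

lemma card_block_le (N i : ℕ) :
    (Finset.univ.filter (fun m : Fin N => block m = i)).card ≤ 4 ^ i := by
  obtain ⟨A, hA⟩ : ∃ A, 3 * A + 1 = 4 ^ i := by
    have h : 4 ^ i % 3 = 1 := by simp [Nat.pow_mod]
    exact ⟨4 ^ i / 3, by omega⟩
  calc _ ≤ (Finset.Ico A (A + 4 ^ i)).card := by
        refine Finset.card_le_card_of_injOn (fun m : Fin N => (m : ℕ)) (fun m hm => ?_)
          Fin.val_injective.injOn
        have hb : block m = i := by simpa using hm
        have h1 := pow_block_le m
        have h2 := lt_pow_block m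
        rw [hb] at h1 h2
        simp only [Finset.coe_Ico, Set.mem_Ico]
        omega
    _ = 4 ^ i := by simp

lemma sum_range_one_div_succ_sq_le (n : ℕ) :
    ∑ j ∈ Finset.range n, 1 / ((j : ℝ) + 1) ^ 2 ≤ 2 := by
  have h : ∀ n : ℕ, ∑ j ∈ Finset.range (n + 1), 1 / ((j : ℝ) + 1) ^ 2 ≤ 2 - 1 / ((n : ℝ) + 1) := by
    intro n
    induction n with
    | zero => norm_num
    | succ n ih =>
      rw [Finset.sum_range_succ]
      have hn : (0 : ℝ) ≤ n := n.cast_nonneg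
      have e : 1 / ((n : ℝ) + 1) - 1 / ((n : ℝ) + 1 + 1) - 1 / ((n : ℝ) + 1 + 1) ^ 2
          = 1 / (((n : ℝ) + 1) * (n + 1 + 1) ^ 2) := by field_simp; ring
      have : 0 ≤ 1 / (((n : ℝ) + 1) * (n + 1 + 1) ^ 2) := by positivity
      push_cast
      linarith
  cases n with
  | zero => norm_num
  | succ n =>
    have : 0 ≤ 1 / ((n : ℝ) + 1) := by positivity
    linarith [h n]

/-- The term `m = k` of this sum is `1 / 0 = 0`. -/
lemma sum_one_div_sub_sq_le (N k : ℕ) : ∑ m : Fin N, 1 / ((k : ℝ) - (m : ℕ)) ^ 2 ≤ 4 := by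
  rw [Fin.sum_univ_eq_sum_range (fun m : ℕ => 1 / ((k : ℝ) - m) ^ 2)]
  have hsub : Finset.range N ⊆ Finset.range (k + 1 + N) := Finset.range_mono (by omega)
  refine (Finset.sum_le_sum_of_subset_of_nonneg hsub fun _ _ _ => by positivity).trans ?_
  rw [Finset.sum_range_add, Finset.sum_range_succ]
  have h1 : ∑ m ∈ Finset.range k, 1 / ((k : ℝ) - m) ^ 2 ≤ 2 := by
    rw [← Finset.sum_range_reflect]
    refine le_trans (le_of_eq (Finset.sum_congr rfl fun j hj => ?_))
      (sum_range_one_div_succ_sq_le k)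
    have hj' := Finset.mem_range.1 hj
    have : ((k - 1 - j : ℕ) : ℝ) = k - 1 - j := by
      rw [Nat.cast_sub (by omega), Nat.cast_sub (by omega), Nat.cast_one]
    rw [this]; ring_nf
  have h2 : ∑ j ∈ Finset.range N, 1 / ((k : ℝ) - ((k + 1 + j : ℕ) : ℝ)) ^ 2 ≤ 2 := by
    refine le_trans (le_of_eq (Finset.sum_congr rfl fun j hj => ?_))
      (sum_range_one_div_succ_sq_le N)
    push_cast; congr 1; ring
  have h3 : 1 / ((k : ℝ) - k) ^ 2 = 0 := by simp
  linarith

lemma pow_block_div_le (k m : ℕ) :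
    (1 / 4 ^ block m : ℝ) * (1 / ((k : ℝ) - m) ^ 2)
      ≤ (1 / 4 ^ block k) * (10 * (1 / ((k : ℝ) - m) ^ 2) + 6 * (1 / ((m : ℝ) + 1) ^ 2)) := by
  have hm0 : (0 : ℝ) ≤ m := m.cast_nonneg
  rcases le_or_gt k m with h | h
  · have hp : (4 : ℝ) ^ block k ≤ 4 ^ block m :=
      pow_le_pow_right₀ (by norm_num) (block_mono h)
    have h1 : (1 / 4 ^ block m : ℝ) ≤ 1 / 4 ^ block k := by gcongr
    have h2 : 0 ≤ 1 / ((k : ℝ) - m) ^ 2 := by positivity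
    have h3 : 0 ≤ 1 / ((m : ℝ) + 1) ^ 2 := by positivity
    exact mul_le_mul h1 (by linarith) h2 (by positivity)
  · have hD : (0 : ℝ) < (k : ℝ) - m := sub_pos.2 (by exact_mod_cast h)
    set D := (k : ℝ) - m with hDdef
    have hk : (4 : ℝ) ^ block k ≤ 3 * k + 1 := by exact_mod_cast pow_block_le k
    have hm : (3 : ℝ) * m + 1 < 4 * 4 ^ block m := by exact_mod_cast lt_pow_block m
    set X := (4 : ℝ) ^ block k
    set Y := (4 : ℝ) ^ block m
    have hX : 0 < X := by positivity
    have hY : 0 < Y := by positivity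
    have hXY : X ≤ 4 * Y + 3 * D := by linarith
    have hYm : ((m : ℝ) + 1) ≤ 4 * Y := by linarith
    have hM : 0 < (m : ℝ) + 1 := by positivity
    set Z := (m : ℝ) + 1
    have hstep : X / Y * (1 / D ^ 2) ≤ 10 * (1 / D ^ 2) + 6 * (1 / Z ^ 2) := by
      have a1 : X / Y ≤ 4 + 12 * D / Z := by
        calc X / Y ≤ (4 * Y + 3 * D) / Y := by gcongr
          _ = 4 + 3 * D / Y := by field_simp
          _ ≤ 4 + 3 * D / (Z / 4) := by gcongr; linarith
          _ = _ := by field_simp; ring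
      have a2 : X / Y * (1 / D ^ 2) ≤ (4 + 12 * D / Z) * (1 / D ^ 2) := by gcongr
      have a3 : 10 * (1 / D ^ 2) + 6 * (1 / Z ^ 2) - (4 + 12 * D / Z) * (1 / D ^ 2)
          = 6 * (1 / D - 1 / Z) ^ 2 := by field_simp; ring
      nlinarith [sq_nonneg (1 / D - 1 / Z)]
    calc 1 / Y * (1 / D ^ 2) = 1 / X * (X / Y * (1 / D ^ 2)) := by field_simp
      _ ≤ _ := by gcongr

lemma sum_off_diagonal_le (N k : ℕ) :
    ∑ m : Fin N, (1 / 4 ^ block m : ℝ) * (1 / (10000 * ((k : ℝ) - (m : ℕ)) ^ 2))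
      ≤ 52 / 10000 * (1 / 4 ^ block k) := by
  have h1 : ∀ m : Fin N, (1 / 4 ^ block m : ℝ) * (1 / (10000 * ((k : ℝ) - (m : ℕ)) ^ 2))
      ≤ (1 / 4 ^ block k) * (1 / 1000 * (1 / ((k : ℝ) - (m : ℕ)) ^ 2)
          + 6 / 10000 * (1 / (((m : ℕ) : ℝ) + 1) ^ 2)) := fun m => by
    have h := pow_block_div_le k m
    have e : (1 / (10000 * ((k : ℝ) - (m : ℕ)) ^ 2)) = 1 / 10000 * (1 / ((k : ℝ) - (m : ℕ)) ^ 2) := by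
      rw [one_div_mul_one_div]
    rw [e]; nlinarith
  refine (Finset.sum_le_sum fun m _ => h1 m).trans ?_
  rw [← Finset.mul_sum, Finset.sum_add_distrib, ← Finset.mul_sum, ← Finset.mul_sum, mul_comm]
  have h2 := sum_one_div_sub_sq_le N k
  have h3 := sum_range_one_div_succ_sq_le N
  rw [← Fin.sum_univ_eq_sum_range (fun m : ℕ => 1 / ((m : ℝ) + 1) ^ 2)] at h3
  gcongr
  linarith

lemma sum_Ico_half_pow_le (i n : ℕ) : ∑ l ∈ Finset.Ico (i + 1) n, (1 / 2 ^ l : ℝ) ≤ 1 / 2 ^ i := by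
  rcases le_or_gt (i + 1) n with h | h
  · have : ∑ l ∈ Finset.Ico (i + 1) n, (1 / 2 ^ l : ℝ) = 1 / 2 ^ i - 2 / 2 ^ n := by
      induction n, h using Nat.le_induction with
      | base => rw [Finset.Ico_self, Finset.sum_empty, pow_succ]; field_simp; ring
      | succ n hn ih =>
        rw [Finset.sum_Ico_succ_top hn, ih, pow_succ]; field_simp; ring
    have h2 : (0 : ℝ) ≤ 2 / 2 ^ n := by positivity
    linarith
  · rw [Finset.Ico_eq_empty (by omega)]; simp

lemma sum_Ico_quarter_pow_le (i n : ℕ) :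
    ∑ l ∈ Finset.Ico i n, (1 / 4 ^ l : ℝ) ≤ 4 / 3 * (1 / 4 ^ i) := by
  rcases le_or_gt i n with h | h
  · have : ∑ l ∈ Finset.Ico i n, (1 / 4 ^ l : ℝ) = 4 / 3 * (1 / 4 ^ i) - 4 / 3 * (1 / 4 ^ n) := by
      induction n, h using Nat.le_induction with
      | base => simp
      | succ n hn ih =>
        rw [Finset.sum_Ico_succ_top hn, ih, pow_succ]; field_simp; ring
    rw [this]; simp
  · rw [Finset.Ico_eq_empty (by omega)]; simp

/-- The bounded-product step of the McGehee–Pigno–Smith construction. -/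
lemma norm_sum_mul_exp_neg_le (g h : ℕ → ℂ) (x : ℕ → ℝ) (hx1 : ∀ i, x i ≤ 1)
    (hg : ∀ i, ‖g i‖ ≤ x i) (n : ℕ) (hh : ∀ i < n, 1 / 5 * x i ≤ (h i).re) :
    ‖∑ i ∈ Finset.range n, g i * Complex.exp (-∑ l ∈ Finset.Ico (i + 1) n, h l)‖ ≤ 6 := by
  induction n with
  | zero => simp
  | succ n ih =>
    have e : ∑ i ∈ Finset.range (n + 1),
          g i * Complex.exp (-∑ l ∈ Finset.Ico (i + 1) (n + 1), h l)
        = (∑ i ∈ Finset.range n, g i * Complex.exp (-∑ l ∈ Finset.Ico (i + 1) n, h l))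
          * Complex.exp (-h n) + g n := by
      rw [Finset.sum_range_succ, Finset.Ico_self, Finset.sum_empty, neg_zero, Complex.exp_zero,
        mul_one, Finset.sum_mul]
      congr 1
      refine Finset.sum_congr rfl fun i hi => ?_
      rw [Finset.sum_Ico_succ_top (Finset.mem_range.1 hi), neg_add, Complex.exp_add, mul_assoc]
    rw [e]
    have hx0 : 0 ≤ x n := (norm_nonneg _).trans (hg n)
    have hexp : ‖Complex.exp (-h n)‖ ≤ 1 / (1 + x n / 5) := by
      rw [Complex.norm_exp, Complex.neg_re]
      calc Real.exp (-(h n).re) ≤ Real.exp (-(x n / 5)) :=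
            Real.exp_le_exp.2 (by linarith [hh n (Nat.lt_succ_self n)])
        _ = 1 / Real.exp (x n / 5) := by rw [Real.exp_neg, one_div]
        _ ≤ 1 / (1 + x n / 5) := by
            gcongr; linarith [Real.add_one_le_exp (x n / 5)]
    have ihn := ih fun i hi => hh i (hi.trans (Nat.lt_succ_self n))
    calc _ ≤ ‖∑ i ∈ Finset.range n, g i * Complex.exp (-∑ l ∈ Finset.Ico (i + 1) n, h l)‖
            * ‖Complex.exp (-h n)‖ + ‖g n‖ := by
          rw [← norm_mul]; exact norm_add_le _ _
      _ ≤ 6 * (1 / (1 + x n / 5)) + x n := by gcongr; exact hg n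
      _ ≤ 6 := by
          have : 6 - (6 * (1 / (1 + x n / 5)) + x n)
              = x n * (1 - x n) / (5 + x n) := by field_simp; ring
          have : 0 ≤ x n * (1 - x n) / (5 + x n) :=
            div_nonneg (mul_nonneg hx0 (by linarith [hx1 n])) (by linarith)
          linarith

lemma one_div_window_le {D x : ℝ} (hD : 1 ≤ D) (hx : 72 * D ≤ x) :
    1 / (2 * x * (x - 1)) ≤ 1 / (10000 * D ^ 2) := by
  apply one_div_le_one_div_of_le (by positivity)
  nlinarith

lemma one_div_window_le' {D x : ℝ} (hD : 1 ≤ D) (hx : 72 * D ≤ x) :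
    1 / (x * (x ^ 2 - 1)) ≤ 1 / (10000 * D ^ 2) := by
  refine le_trans ?_ (one_div_window_le hD hx)
  apply one_div_le_one_div_of_le
  · have : 0 < x - 1 := by linarith
    have : 0 < x := by linarith
    positivity
  · have h1 : 0 ≤ x * (x - 1) := mul_nonneg (by linarith) (by linarith)
    nlinarith

lemma norm_integral_hann_mul_wave_sub_le {N : ℕ} {μ : Fin N → ℝ}
    (hμ : ∀ k l : Fin N, k < l → 72 * (((l : ℕ) : ℝ) - (k : ℕ)) ≤ μ l - μ k) (k m : Fin N) :
    ‖(∫ s in (-(1/2 : ℝ))..(1/2), (hann s : ℂ) * wave (μ k - μ m) s) - if m = k then 1 / 2 else 0‖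
      ≤ 1 / (10000 * (((k : ℕ) : ℝ) - (m : ℕ)) ^ 2) := by
  have key : ∀ p q : Fin N, p < q → ∀ x : ℝ, |x| = μ q - μ p →
      ‖∫ s in (-(1/2 : ℝ))..(1/2), (hann s : ℂ) * wave x s‖
        ≤ 1 / (10000 * (((q : ℕ) : ℝ) - (p : ℕ)) ^ 2) := by
    intro p q hpq x hx
    have h1 : (1 : ℝ) ≤ ((q : ℕ) : ℝ) - (p : ℕ) := by
      have : ((p : ℕ) : ℝ) + 1 ≤ (q : ℕ) := by exact_mod_cast (hpq : (p : ℕ) < q)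
      linarith
    have h2 : 72 * (((q : ℕ) : ℝ) - (p : ℕ)) ≤ |x| := hx ▸ hμ p q hpq
    refine (norm_integral_hann_mul_wave_le (by linarith)).trans ?_
    rw [← sq_abs x]
    exact one_div_window_le' h1 h2
  rcases lt_trichotomy m k with h | h | h
  · rw [if_neg h.ne, sub_zero]
    refine key m k h _ (abs_of_nonneg ?_)
    have : ((m : ℕ) : ℝ) ≤ (k : ℕ) := by exact_mod_cast (h : (m : ℕ) < k).le
    linarith [hμ m k h]
  · subst h
    rw [if_pos rfl, sub_self, integral_hann_mul_wave_zero]; simp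
  · rw [if_neg h.ne', sub_zero, ← neg_sub ((m : ℕ) : ℝ), neg_sq]
    refine key k m h _ ?_
    rw [abs_sub_comm]
    refine abs_of_nonneg ?_
    have : ((k : ℕ) : ℝ) ≤ (m : ℕ) := by exact_mod_cast (h : (k : ℕ) < m).le
    linarith [hμ k m h]

/-- The normalized exponential sum over the `i`-th block, with coefficients `θ` and conjugate
frequencies. -/
noncomputable def blockPoly {N : ℕ} (μ : Fin N → ℝ) (θ : Fin N → ℂ) (i : ℕ) (s : ℝ) : ℂ :=
  ∑ m ∈ Finset.univ.filter (fun m : Fin N => block m = i), θ m / 4 ^ i * wave (-μ m) s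

lemma continuous_blockPoly {N : ℕ} (μ : Fin N → ℝ) (θ : Fin N → ℂ) (i : ℕ) :
    Continuous (blockPoly μ θ i) := by
  have := continuous_wave
  unfold blockPoly; fun_prop

lemma norm_coeff_le {z : ℂ} (hz : ‖z‖ ≤ 1) (i : ℕ) : ‖z / 4 ^ i‖ ≤ 1 / 4 ^ i := by
  rw [norm_div, norm_pow]
  have : ‖(4 : ℂ)‖ = 4 := by simp
  rw [this]; gcongr

lemma norm_blockPoly_le {N : ℕ} (μ : Fin N → ℝ) {θ : Fin N → ℂ} (hθ : ∀ m, ‖θ m‖ ≤ 1) (i : ℕ)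
    (s : ℝ) : ‖blockPoly μ θ i s‖ ≤ 1 := by
  refine (norm_sum_le_of_le _ (n := fun _ => (1 / 4 ^ i : ℝ)) fun m _ => ?_).trans ?_
  · rw [norm_mul, norm_wave, mul_one]; exact norm_coeff_le (hθ m) i
  · rw [Finset.sum_const, nsmul_eq_mul, mul_one_div, div_le_one (by positivity)]
    exact_mod_cast card_block_le N i

lemma integral_hann_mul_blockPoly_sq_le {N : ℕ} {μ : Fin N → ℝ}
    (hμ : ∀ k l : Fin N, k < l → 72 * (((l : ℕ) : ℝ) - (k : ℕ)) ≤ μ l - μ k)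
    {θ : Fin N → ℂ} (hθ : ∀ m, ‖θ m‖ ≤ 1) (i : ℕ) :
    ∫ s in (-(1/2 : ℝ))..(1/2), hann s * ‖blockPoly μ θ i s‖ ^ 2 ≤ (3 / 4 / 2 ^ i) ^ 2 := by
  have h := integral_weighted_norm_sq (Finset.univ.filter fun m : Fin N => block m = i)
    (fun m => θ m / 4 ^ i) (fun m => -μ m) continuous_hann
  have hnn : 0 ≤ ∫ s in (-(1/2 : ℝ))..(1/2), hann s * ‖blockPoly μ θ i s‖ ^ 2 :=
    intervalIntegral.integral_nonneg (by norm_num) fun s _ =>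
      mul_nonneg (hann_nonneg s) (sq_nonneg _)
  have hn := congrArg norm h
  rw [Complex.norm_real] at hn
  change ‖∫ s in (-(1/2 : ℝ))..(1/2), hann s * ‖blockPoly μ θ i s‖ ^ 2‖ = _ at hn
  rw [Real.norm_of_nonneg hnn] at hn
  rw [hn]
  have hterm : ∀ m m' : Fin N, ‖θ m / 4 ^ i * (starRingEnd ℂ) (θ m' / 4 ^ i) *
      ∫ s in (-(1/2 : ℝ))..(1/2), (hann s : ℂ) * wave (-μ m - -μ m') s‖
      ≤ (1 / 4 ^ i) * (1 / 4 ^ i) * ((if m' = m then 1 / 2 else 0)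
        + 1 / 10000 * (1 / (((m : ℕ) : ℝ) - (m' : ℕ)) ^ 2)) := by
    intro m m'
    rw [norm_mul, norm_mul, RCLike.norm_conj]
    have e : -μ m - -μ m' = μ m' - μ m := by ring
    rw [e]
    have hw := norm_integral_hann_mul_wave_sub_le hμ m' m
    have hw2 : ‖∫ s in (-(1/2 : ℝ))..(1/2), (hann s : ℂ) * wave (μ m' - μ m) s‖
        ≤ (if m' = m then 1 / 2 else 0) + 1 / 10000 * (1 / (((m : ℕ) : ℝ) - (m' : ℕ)) ^ 2) := by
      rw [one_div_mul_one_div, ← neg_sub ((m' : ℕ) : ℝ), neg_sq]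
      refine (norm_le_norm_add_norm_sub' _ (if m = m' then 1 / 2 else 0)).trans
        (add_le_add ?_ hw)
      by_cases h : m' = m
      · simp [h]
      · simp [h, Ne.symm h]
    gcongr
    · exact norm_coeff_le (hθ m) i
    · exact norm_coeff_le (hθ m') i
  have hrow : ∀ m : Fin N, ∑ m' ∈ Finset.univ.filter (fun m' : Fin N => block m' = i),
      (1 / 4 ^ i : ℝ) * (1 / 4 ^ i) * ((if m' = m then 1 / 2 else 0)
        + 1 / 10000 * (1 / (((m : ℕ) : ℝ) - (m' : ℕ)) ^ 2)) ≤
      (1 / 4 ^ i) * (1 / 4 ^ i) * (9 / 16) := by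
    intro m
    rw [← Finset.mul_sum]
    gcongr
    refine (Finset.sum_le_sum_of_subset_of_nonneg (Finset.subset_univ _) fun m' _ _ => ?_).trans ?_
    · split_ifs <;> positivity
    · rw [Finset.sum_add_distrib, ← Finset.mul_sum]
      have := sum_one_div_sub_sq_le N m
      simp only [Finset.sum_ite_eq', Finset.mem_univ, if_true]
      linarith
  refine (norm_sum_le_of_le _ fun m _ => (norm_sum_le_of_le _ fun m' _ => hterm m m').trans
    (hrow m)).trans ?_
  rw [Finset.sum_const, nsmul_eq_mul]
  have hc : (((Finset.univ.filter fun m : Fin N => block m = i).card : ℕ) : ℝ) ≤ 4 ^ i := by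
    exact_mod_cast card_block_le N i
  have e4 : (4 : ℝ) ^ i = 2 ^ i * 2 ^ i := by rw [← mul_pow]; norm_num
  calc _ ≤ (4 : ℝ) ^ i * (1 / 4 ^ i * (1 / 4 ^ i) * (9 / 16)) := by gcongr
    _ = (3 / 4 / 2 ^ i) ^ 2 := by rw [e4]; field_simp; norm_num

lemma integral_hann_mul_wave_mul_blockPoly {N : ℕ} (μ : Fin N → ℝ) (θ : Fin N → ℂ) (i : ℕ)
    (y : ℝ) {g : ℝ → ℂ} (hg : Continuous g) :
    ∫ s in (-(1/2 : ℝ))..(1/2), (hann s : ℂ) * wave y s * blockPoly μ θ i s * g s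
      = ∑ m ∈ Finset.univ.filter (fun m : Fin N => block m = i), θ m / 4 ^ i *
          ∫ s in (-(1/2 : ℝ))..(1/2), (hann s : ℂ) * wave (y - μ m) s * g s := by
  have cw := continuous_wave
  have ch := continuous_hann
  simp_rw [← intervalIntegral.integral_const_mul]
  rw [← intervalIntegral.integral_finsetSum
    (fun i _ => Continuous.intervalIntegrable (by fun_prop) _ _)]
  congr 1; ext s
  rw [blockPoly, Finset.mul_sum, Finset.sum_mul]
  refine Finset.sum_congr rfl fun m _ => ?_
  rw [sub_eq_add_neg, wave_add]; ring

/-- The contribution of earlier blocks at the frequency `μ k`. -/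
lemma norm_integral_blockPoly_mul_analytic_le {N : ℕ} {μ : Fin N → ℝ}
    (hμ : ∀ k l : Fin N, k < l → 72 * (((l : ℕ) : ℝ) - (k : ℕ)) ≤ μ l - μ k)
    {θ : Fin N → ℂ} (hθ : ∀ m, ‖θ m‖ ≤ 1) {E : ℂ → ℂ} (hE : Differentiable ℂ E)
    (hb : ∀ s ∈ Set.Icc (-(1/2) : ℝ) (1/2), ‖E (wave 1 s)‖ ≤ 1) {i : ℕ} {k : Fin N}
    (hik : i < block k) :
    ‖∫ s in (-(1/2 : ℝ))..(1/2), (hann s : ℂ) * wave (μ k) s * blockPoly μ θ i s * E (wave 1 s)‖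
      ≤ ∑ m ∈ Finset.univ.filter (fun m : Fin N => block m = i),
          (1 / 4 ^ block m : ℝ) * (1 / (10000 * (((k : ℕ) : ℝ) - (m : ℕ)) ^ 2)) := by
  rw [integral_hann_mul_wave_mul_blockPoly μ θ i (μ k) (g := fun s => E (wave 1 s))
    (hE.continuous.comp (continuous_wave 1))]
  refine norm_sum_le_of_le _ fun m hm => ?_
  have hmi : block m = i := (Finset.mem_filter.1 hm).2
  have hmk : (m : ℕ) < k := by
    by_contra hcon
    have := block_mono (not_lt.1 hcon)
    omega
  have h1 : (1 : ℝ) ≤ ((k : ℕ) : ℝ) - (m : ℕ) := by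
    have : ((m : ℕ) : ℝ) + 1 ≤ (k : ℕ) := by exact_mod_cast hmk
    linarith
  have h2 := hμ m k hmk
  rw [norm_mul, hmi]
  refine mul_le_mul (norm_coeff_le (hθ m) i) ?_ (norm_nonneg _) (by positivity)
  exact (norm_integral_hann_mul_wave_mul_analytic_le hE hb (by linarith)).trans
    (one_div_window_le h1 h2)

lemma norm_integral_blockPoly_sub_le {N : ℕ} {μ : Fin N → ℝ}
    (hμ : ∀ k l : Fin N, k < l → 72 * (((l : ℕ) : ℝ) - (k : ℕ)) ≤ μ l - μ k)
    {θ : Fin N → ℂ} (hθ : ∀ m, ‖θ m‖ ≤ 1) (i : ℕ) (k : Fin N) :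
    ‖(∫ s in (-(1/2 : ℝ))..(1/2), (hann s : ℂ) * wave (μ k) s * blockPoly μ θ i s)
        - if i = block k then θ k / 4 ^ block k / 2 else 0‖
      ≤ ∑ m ∈ Finset.univ.filter (fun m : Fin N => block m = i),
          (1 / 4 ^ block m : ℝ) * (1 / (10000 * (((k : ℕ) : ℝ) - (m : ℕ)) ^ 2)) := by
  have h := integral_hann_mul_wave_mul_blockPoly μ θ i (μ k) (g := fun _ => 1) continuous_const
  simp only [mul_one] at h
  have e : (if i = block k then θ k / 4 ^ block k / 2 else 0)
      = ∑ m ∈ Finset.univ.filter (fun m : Fin N => block m = i),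
          θ m / 4 ^ i * (if m = k then 1 / 2 else 0) := by
    simp only [mul_ite, mul_zero, Finset.sum_ite_eq', Finset.mem_filter, Finset.mem_univ, true_and]
    by_cases hik : i = block k
    · subst hik; simp; ring
    · rw [if_neg hik, if_neg (Ne.symm hik)]
  rw [h, e, ← Finset.sum_sub_distrib]
  refine norm_sum_le_of_le _ fun m hm => ?_
  have hmi : block m = i := (Finset.mem_filter.1 hm).2
  rw [← mul_sub, norm_mul, hmi]
  exact mul_le_mul (norm_coeff_le (hθ m) i) (norm_integral_hann_mul_wave_sub_le hμ k m)
    (norm_nonneg _) (by positivity)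

/-- Cauchy–Schwarz for a windowed block against a function bounded in
mean square. -/
lemma integral_hann_norm_blockPoly_mul_le {N : ℕ} {μ : Fin N → ℝ}
    (hμ : ∀ k l : Fin N, k < l → 72 * (((l : ℕ) : ℝ) - (k : ℕ)) ≤ μ l - μ k)
    {θ : Fin N → ℂ} (hθ : ∀ m, ‖θ m‖ ≤ 1) (i : ℕ) {p : ℝ → ℂ} (hp : Continuous p) {B : ℝ}
    (hB : 0 < B) (hpB : ∫ s in (-(1/2 : ℝ))..(1/2), ‖p s‖ ^ 2 ≤ B ^ 2) :
    ∫ s in (-(1/2 : ℝ))..(1/2), hann s * ‖blockPoly μ θ i s‖ * ‖p s‖ ≤ 3 / 4 / 2 ^ i * B := by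
  have ch := continuous_hann
  have cf := continuous_blockPoly μ θ i
  refine integral_mul_le_of_sq_le (f := fun s => hann s * ‖blockPoly μ θ i s‖)
    (g := fun s => ‖p s‖) (by fun_prop) (by fun_prop) (by positivity) hB ?_ hpB
  refine le_trans ?_ (integral_hann_mul_blockPoly_sq_le hμ hθ i)
  refine intervalIntegral.integral_mono_on (by norm_num)
    (Continuous.intervalIntegrable (by fun_prop) _ _)
    (Continuous.intervalIntegrable (by fun_prop) _ _) fun s _ => ?_
  rw [mul_pow]
  gcongr
  rw [sq]
  exact mul_le_of_le_one_left (hann_nonneg s) (hann_le_one s)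

/-- An entire function whose real part on the circle dominates a windowed block. -/
lemma exists_blockPoly_majorant {N : ℕ} {μ : Fin N → ℝ}
    (hμ : ∀ k l : Fin N, k < l → 72 * (((l : ℕ) : ℝ) - (k : ℕ)) ≤ μ l - μ k)
    {θ : Fin N → ℂ} (hθ : ∀ m, ‖θ m‖ ≤ 1) (i : ℕ) :
    ∃ P : ℂ → ℂ, Differentiable ℂ P ∧
      (∀ s ∈ Set.Icc (-(1/2) : ℝ) (1/2),
        1 / 5 * (hann s * ‖blockPoly μ θ i s‖) ≤ (P (wave 1 s)).re) ∧
      ∫ s in (-(1/2 : ℝ))..(1/2), ‖P (wave 1 s)‖ ^ 2 ≤ (3 / 10 / 2 ^ i) ^ 2 := by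
  have ch := continuous_hann
  have cf := continuous_blockPoly μ θ i
  have h1 : hann (1/2) = 0 := by
    rw [hann, show 2 * Real.pi * (1/2) = Real.pi by ring, Real.cos_pi]; norm_num
  have h2 : hann (-(1/2)) = 0 := by
    rw [hann, show 2 * Real.pi * (-(1/2)) = -Real.pi by ring, Real.cos_neg, Real.cos_pi]; norm_num
  obtain ⟨P, hP, hre, hsq⟩ := exists_entire_majorant
    (u := fun s => 1 / 5 * (hann s * ‖blockPoly μ θ i s‖)) (A := 3 / 20 / 2 ^ i)
    (by fun_prop) (by simp only [h1, h2, zero_mul]) (by positivity) (by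
      have hb := integral_hann_mul_blockPoly_sq_le hμ hθ i
      have : ∫ s in (-(1/2 : ℝ))..(1/2), (1 / 5 * (hann s * ‖blockPoly μ θ i s‖)) ^ 2
          ≤ ∫ s in (-(1/2 : ℝ))..(1/2), 1 / 25 * (hann s * ‖blockPoly μ θ i s‖ ^ 2) := by
        refine intervalIntegral.integral_mono_on (by norm_num)
          (Continuous.intervalIntegrable (by fun_prop) _ _)
          (Continuous.intervalIntegrable (by fun_prop) _ _) fun s _ => ?_
        have : hann s ^ 2 ≤ hann s := by
          rw [sq]; exact mul_le_of_le_one_left (hann_nonneg s) (hann_le_one s)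
        calc _ = 1 / 25 * (hann s ^ 2 * ‖blockPoly μ θ i s‖ ^ 2) := by ring
          _ ≤ _ := by gcongr
      refine this.trans ?_
      rw [intervalIntegral.integral_const_mul]
      refine (mul_le_mul_of_nonneg_left hb (by norm_num)).trans (le_of_eq ?_)
      rw [div_pow, div_pow]; ring)
  refine ⟨P, hP, hre, hsq.trans (le_of_eq ?_)⟩
  rw [div_pow, mul_pow, div_pow]; ring

/-- The bounded test function of the non-harmonic Littlewood inequality. -/
lemma exists_dual_function {N : ℕ} {μ : Fin N → ℝ}
    (hμ : ∀ k l : Fin N, k < l → 72 * (((l : ℕ) : ℝ) - (k : ℕ)) ≤ μ l - μ k)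
    {θ : Fin N → ℂ} (hθ : ∀ m, ‖θ m‖ ≤ 1) :
    ∃ F : ℝ → ℂ, Continuous F ∧ (∀ s ∈ Set.Icc (-(1/2) : ℝ) (1/2), ‖F s‖ ≤ 6) ∧
      ∀ k : Fin N, ‖(∫ s in (-(1/2 : ℝ))..(1/2), wave (μ k) s * F s) - θ k / 4 ^ block k / 2‖
        ≤ 3052 / 10000 * (1 / 4 ^ block k) := by
  choose P hP hre hsq using fun i => exists_blockPoly_majorant hμ hθ i
  have ch := continuous_hann
  have cw := continuous_wave
  have cf := fun i => continuous_blockPoly μ θ i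
  have cP : ∀ i, Continuous (P i) := fun i => (hP i).continuous
  set L := block N + 1 with hL
  let E : ℕ → ℂ → ℂ := fun i z => Complex.exp (-∑ l ∈ Finset.Ico (i + 1) L, P l z)
  have hE : ∀ i, Differentiable ℂ (E i) := fun i =>
    (Differentiable.fun_sum fun l _ => hP l).neg.cexp
  have cE : ∀ i, Continuous (E i) := fun i => (hE i).continuous
  have hre0 : ∀ i, ∀ s ∈ Set.Icc (-(1/2) : ℝ) (1/2),
      0 ≤ (∑ l ∈ Finset.Ico (i + 1) L, P l (wave 1 s)).re := by
    intro i s hs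
    rw [Complex.re_sum]
    refine Finset.sum_nonneg fun l _ => le_trans ?_ (hre l s hs)
    have := hann_nonneg s
    positivity
  have hEb : ∀ i, ∀ s ∈ Set.Icc (-(1/2) : ℝ) (1/2), ‖E i (wave 1 s)‖ ≤ 1 := by
    intro i s hs
    rw [Complex.norm_exp, Complex.neg_re]
    exact Real.exp_le_one_iff.2 (neg_nonpos.2 (hre0 i s hs))
  refine ⟨fun s => ∑ i ∈ Finset.range L, (hann s : ℂ) * blockPoly μ θ i s * E i (wave 1 s),
    by fun_prop, fun s hs => ?_, fun k => ?_⟩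
  · refine norm_sum_mul_exp_neg_le (fun i => (hann s : ℂ) * blockPoly μ θ i s)
      (fun l => P l (wave 1 s)) (fun i => hann s * ‖blockPoly μ θ i s‖) (fun i => ?_)
      (fun i => ?_) L fun i _ => hre i s hs
    · exact mul_le_one₀ (hann_le_one s) (norm_nonneg _) (norm_blockPoly_le μ hθ i s)
    · rw [norm_mul, Complex.norm_real, Real.norm_of_nonneg (hann_nonneg s)]
  have hsplit : ∫ s in (-(1/2 : ℝ))..(1/2), wave (μ k) s *
        ∑ i ∈ Finset.range L, (hann s : ℂ) * blockPoly μ θ i s * E i (wave 1 s)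
      = ∑ i ∈ Finset.range L, ∫ s in (-(1/2 : ℝ))..(1/2),
          (hann s : ℂ) * wave (μ k) s * blockPoly μ θ i s * E i (wave 1 s) := by
    rw [← intervalIntegral.integral_finsetSum
      (fun i _ => Continuous.intervalIntegrable (by fun_prop) _ _)]
    congr 1; ext s
    rw [Finset.mul_sum]
    exact Finset.sum_congr rfl fun i _ => by ring
  have hkL : block k < L := Nat.lt_succ_of_le (block_mono k.2.le)
  have hmain : θ k / 4 ^ block k / 2
      = ∑ i ∈ Finset.range L, if i = block k then θ k / 4 ^ block k / 2 else 0 := by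
    rw [Finset.sum_ite_eq' (Finset.range L) (block k), if_pos (Finset.mem_range.2 hkL)]
  let D : ℕ → ℝ := fun i => ∑ m ∈ Finset.univ.filter (fun m : Fin N => block m = i),
    (1 / 4 ^ block m : ℝ) * (1 / (10000 * (((k : ℕ) : ℝ) - (m : ℕ)) ^ 2))
  have hD : ∑ i ∈ Finset.range L, D i ≤ 52 / 10000 * (1 / 4 ^ block k) := by
    refine le_trans (le_of_eq ?_) (sum_off_diagonal_le N k)
    exact Finset.sum_fiberwise_of_maps_to (g := fun m : Fin N => block m)
      (fun m _ => Finset.mem_range.2 (Nat.lt_succ_of_le (block_mono m.2.le))) _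
  have hpert : ∀ i, ‖∫ s in (-(1/2 : ℝ))..(1/2),
      (hann s : ℂ) * wave (μ k) s * blockPoly μ θ i s * (E i (wave 1 s) - 1)‖
        ≤ 9 / 40 * (1 / 4 ^ i) := by
    intro i
    have h1 : ‖∫ s in (-(1/2 : ℝ))..(1/2),
        (hann s : ℂ) * wave (μ k) s * blockPoly μ θ i s * (E i (wave 1 s) - 1)‖
        ≤ ∫ s in (-(1/2 : ℝ))..(1/2), ∑ l ∈ Finset.Ico (i + 1) L,
            hann s * ‖blockPoly μ θ i s‖ * ‖P l (wave 1 s)‖ := by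
      refine (intervalIntegral.norm_integral_le_integral_norm (by norm_num)).trans ?_
      refine intervalIntegral.integral_mono_on (by norm_num)
        (Continuous.intervalIntegrable (by fun_prop) _ _)
        (Continuous.intervalIntegrable (by fun_prop) _ _) fun s hs => ?_
      rw [norm_mul, norm_mul, norm_mul, norm_wave, mul_one, Complex.norm_real,
        Real.norm_of_nonneg (hann_nonneg s), ← Finset.mul_sum]
      refine mul_le_mul_of_nonneg_left ?_ (mul_nonneg (hann_nonneg s) (norm_nonneg _))
      exact (norm_exp_neg_sub_one_le (hre0 i s hs)).trans (norm_sum_le _ _)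
    rw [intervalIntegral.integral_finsetSum
      (fun l _ => Continuous.intervalIntegrable (by fun_prop) _ _)] at h1
    refine h1.trans ((Finset.sum_le_sum fun l _ =>
      integral_hann_norm_blockPoly_mul_le hμ hθ i (p := fun s => P l (wave 1 s)) (by fun_prop)
        (B := 3 / 10 / 2 ^ l) (by positivity) (hsq l)).trans ?_)
    have h2 := sum_Ico_half_pow_le i L
    have e : ∀ l, 3 / 4 / 2 ^ i * (3 / 10 / 2 ^ l) = 9 / 40 * (1 / 2 ^ i) * (1 / 2 ^ l : ℝ) :=
      fun l => by ring
    simp_rw [e]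
    rw [← Finset.mul_sum]
    have e4 : (4 : ℝ) ^ i = 2 ^ i * 2 ^ i := by rw [← mul_pow]; norm_num
    calc _ ≤ 9 / 40 * (1 / 2 ^ i) * (1 / 2 ^ i : ℝ) := by gcongr
      _ = _ := by rw [e4]; field_simp
  have hterm : ∀ i ∈ Finset.range L, ‖(∫ s in (-(1/2 : ℝ))..(1/2),
      (hann s : ℂ) * wave (μ k) s * blockPoly μ θ i s * E i (wave 1 s))
        - if i = block k then θ k / 4 ^ block k / 2 else 0‖
      ≤ D i + if block k ≤ i then 9 / 40 * (1 / 4 ^ i) else 0 := by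
    intro i _
    by_cases hi : i < block k
    · rw [if_neg hi.ne, sub_zero, if_neg (not_le.2 hi), add_zero]
      exact norm_integral_blockPoly_mul_analytic_le hμ hθ (hE i) (hEb i) hi
    · rw [if_pos (not_lt.1 hi)]
      have e : (∫ s in (-(1/2 : ℝ))..(1/2),
          (hann s : ℂ) * wave (μ k) s * blockPoly μ θ i s * E i (wave 1 s))
          = (∫ s in (-(1/2 : ℝ))..(1/2), (hann s : ℂ) * wave (μ k) s * blockPoly μ θ i s)
            + ∫ s in (-(1/2 : ℝ))..(1/2),
              (hann s : ℂ) * wave (μ k) s * blockPoly μ θ i s * (E i (wave 1 s) - 1) := by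
        rw [← intervalIntegral.integral_add (Continuous.intervalIntegrable (by fun_prop) _ _)
          (Continuous.intervalIntegrable (by fun_prop) _ _)]
        congr 1; ext s; ring
      rw [e, add_sub_right_comm]
      exact (norm_add_le _ _).trans
        (add_le_add (norm_integral_blockPoly_sub_le hμ hθ i k) (hpert i))
  rw [hsplit, hmain, ← Finset.sum_sub_distrib]
  refine (norm_sum_le_of_le _ hterm).trans ?_
  rw [Finset.sum_add_distrib, ← Finset.sum_filter]
  have hIco : (Finset.range L).filter (fun i => block k ≤ i) = Finset.Ico (block k) L := by
    ext i; simp [and_comm]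
  have hq := sum_Ico_quarter_pow_le (block k) L
  rw [hIco, ← Finset.mul_sum]
  linarith

/-- The inequality on the unit interval, for frequencies separated by `72`. -/
lemma sum_norm_div_le_integral_norm_sum_wave {N : ℕ} {μ : Fin N → ℝ}
    (hμ : ∀ k l : Fin N, k < l → 72 * (((l : ℕ) : ℝ) - (k : ℕ)) ≤ μ l - μ k) (a : Fin N → ℂ) :
    (1 / 122 : ℝ) * ∑ k, ‖a k‖ / ((k : ℕ) + 2 : ℝ)
      ≤ ∫ s in (-(1/2 : ℝ))..(1/2), ‖∑ k, a k * wave (μ k) s‖ := by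
  have cw := continuous_wave
  let θ : Fin N → ℂ := fun k => (starRingEnd ℂ) (a k) / ‖a k‖
  have hθ : ∀ k, ‖θ k‖ ≤ 1 := fun k => by
    simp only [θ, norm_div, RCLike.norm_conj, Complex.norm_real, norm_norm]
    exact div_self_le_one _
  have haθ : ∀ k, a k * θ k = ‖a k‖ := fun k => by
    by_cases h : ‖a k‖ = 0
    · simp [θ, norm_eq_zero.1 h]
    · have h2 : (‖a k‖ : ℂ) ≠ 0 := by exact_mod_cast h
      simp only [θ]
      rw [← mul_div_assoc, Complex.mul_conj, Complex.normSq_eq_norm_sq]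
      push_cast
      field_simp
  obtain ⟨F, cF, hF6, hF⟩ := exists_dual_function hμ hθ
  have hupper : ‖∫ s in (-(1/2 : ℝ))..(1/2), (∑ k, a k * wave (μ k) s) * F s‖
      ≤ 6 * ∫ s in (-(1/2 : ℝ))..(1/2), ‖∑ k, a k * wave (μ k) s‖ := by
    refine (intervalIntegral.norm_integral_le_integral_norm (by norm_num)).trans ?_
    rw [← intervalIntegral.integral_const_mul]
    refine intervalIntegral.integral_mono_on (by norm_num)
      (Continuous.intervalIntegrable (by fun_prop) _ _)
      (Continuous.intervalIntegrable (by fun_prop) _ _) fun s hs => ?_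
    rw [norm_mul, mul_comm]
    exact mul_le_mul_of_nonneg_right (hF6 s hs) (norm_nonneg _)
  have hexp : ∫ s in (-(1/2 : ℝ))..(1/2), (∑ k, a k * wave (μ k) s) * F s
      = ∑ k, a k * ∫ s in (-(1/2 : ℝ))..(1/2), wave (μ k) s * F s := by
    simp_rw [← intervalIntegral.integral_const_mul]
    rw [← intervalIntegral.integral_finsetSum
      (fun i _ => Continuous.intervalIntegrable (by fun_prop) _ _)]
    simp_rw [Finset.sum_mul, mul_assoc]
  have hlower : ∑ k, ‖a k‖ * (1948 / 10000 * (1 / 4 ^ block k))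
      ≤ ‖∫ s in (-(1/2 : ℝ))..(1/2), (∑ k, a k * wave (μ k) s) * F s‖ := by
    refine le_trans ?_ (Complex.re_le_norm _)
    rw [hexp, Complex.re_sum]
    refine Finset.sum_le_sum fun k _ => ?_
    set I := ∫ s in (-(1/2 : ℝ))..(1/2), wave (μ k) s * F s
    have e : a k * I = ((‖a k‖ * (1 / 4 ^ block k) / 2 : ℝ) : ℂ)
        + a k * (I - θ k / 4 ^ block k / 2) := by
      push_cast
      rw [← haθ k]; ring
    rw [e, Complex.add_re, Complex.ofReal_re]
    have h1 : ‖a k * (I - θ k / 4 ^ block k / 2)‖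
        ≤ ‖a k‖ * (3052 / 10000 * (1 / 4 ^ block k)) := by
      rw [norm_mul]; exact mul_le_mul_of_nonneg_left (hF k) (norm_nonneg _)
    have h2 := (abs_le.1 (Complex.abs_re_le_norm (a k * (I - θ k / 4 ^ block k / 2)))).1
    linarith
  have hcmp : (6 / 122 : ℝ) * ∑ k, ‖a k‖ / ((k : ℕ) + 2 : ℝ)
      ≤ ∑ k : Fin N, ‖a k‖ * (1948 / 10000 * (1 / 4 ^ block k)) := by
    rw [Finset.mul_sum]
    refine Finset.sum_le_sum fun k _ => ?_
    have h4 : (4 : ℝ) ^ block k ≤ 3 * ((k : ℕ) + 2) := by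
      have : ((4 ^ block k : ℕ) : ℝ) ≤ ((3 * (k : ℕ) + 1 : ℕ) : ℝ) := by
        exact_mod_cast pow_block_le k
      push_cast at this
      linarith
    have h5 : 1 / (3 * ((k : ℕ) + 2) : ℝ) ≤ 1 / 4 ^ block k :=
      one_div_le_one_div_of_le (by positivity) h4
    have h6 : 0 < 1 / ((k : ℕ) + 2 : ℝ) := by positivity
    have e3 : 1 / (3 * ((k : ℕ) + 2) : ℝ) = 1 / 3 * (1 / ((k : ℕ) + 2)) := by
      rw [one_div_mul_one_div]
    calc (6 / 122 : ℝ) * (‖a k‖ / ((k : ℕ) + 2 : ℝ))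
        = ‖a k‖ * (6 / 122 * (1 / ((k : ℕ) + 2))) := by ring
      _ ≤ _ := by
        refine mul_le_mul_of_nonneg_left ?_ (norm_nonneg _)
        linarith
  linarith

/-- Main theorem (iii): quantitative finite-interval non-harmonic Littlewood
inequality for separated frequencies and T ≥ 72. -/
theorem finite_interval_littlewood (N : ℕ) (lam : Fin N → ℝ) (hlam : StrictMono lam)
    (hsep : ∀ k l : Fin N, |((k : ℕ) : ℝ) - ((l : ℕ) : ℝ)| ≤ |lam k - lam l|)
    (a : Fin N → ℂ) (T : ℝ) (hT : 72 ≤ T) :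
    (1 / 122 : ℝ) * ∑ k : Fin N, ‖a k‖ / ((k : ℕ) + 2 : ℝ) ≤
      (1 / T) * ∫ t in (-(T/2))..(T/2),
        ‖∑ k : Fin N, a k * Complex.exp (((2 * Real.pi * lam k * t : ℝ) : ℂ) * Complex.I)‖ := by
  have hT0 : T ≠ 0 := by linarith
  have hμ : ∀ k l : Fin N, k < l →
      72 * (((l : ℕ) : ℝ) - (k : ℕ)) ≤ T * lam l - T * lam k := by
    intro k l hkl
    have h1 : ((k : ℕ) : ℝ) ≤ (l : ℕ) := by exact_mod_cast (hkl : (k : ℕ) < l).le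
    have h2 := hsep l k
    rw [abs_of_nonneg (by linarith), abs_of_pos (sub_pos.2 (hlam hkl))] at h2
    rw [← mul_sub]
    exact mul_le_mul hT h2 (by linarith) (by linarith)
  refine (sum_norm_div_le_integral_norm_sum_wave (μ := fun k => T * lam k) hμ a).trans
    (le_of_eq ?_)
  have h := intervalIntegral.integral_comp_mul_left (a := -(1/2 : ℝ)) (b := 1/2)
    (fun t => ‖∑ k : Fin N, a k * wave (lam k) t‖) hT0
  rw [smul_eq_mul, show T * -(1/2) = -(T / 2) by ring, show T * (1/2) = T / 2 by ring,
    ← one_div] at h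
  refine Eq.trans ?_ h
  congr 1; ext s
  congr 1
  refine Finset.sum_congr rfl fun k _ => ?_
  rw [show wave (T * lam k) s = wave (lam k) (T * s) by
    rw [wave, wave, show 2 * Real.pi * (T * lam k) * s = 2 * Real.pi * lam k * (T * s) by ring]]
end

section
/- Let λ_1, ..., λ_N be real numbers with |λ_k − λ_ℓ| ≥ 1 for k ≠ ℓ, let u_1, ..., u_N be complex numbers of modulus 1, let I be an interval of length L > 0 centered at 0, and set f(t) = ∑_{k=1}^N u_k e^{-2πi λ_k t}. Then ∫_I |f(t)|² dt ≤ (L + 1) N. -/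
open MeasureTheory intervalIntegral

section HilbertInequality

open Finset ComplexConjugate ComplexOrder

variable {ι : Type*}

/-- The reciprocal squares of 1-separated reals that are at least 1 sum to at most `ζ(2)`. -/
lemma sum_inv_sq_le_of_one_le {s : Finset ι} {x : ι → ℝ} (hx : ∀ k ∈ s, 1 ≤ x k)
    (hsep : ∀ k ∈ s, ∀ l ∈ s, k ≠ l → 1 ≤ |x k - x l|) :
    ∑ k ∈ s, (x k)⁻¹ ^ 2 ≤ Real.pi ^ 2 / 6 := by
  classical
  have hinj : Set.InjOn (fun k => ⌊x k⌋₊) s := by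
    intro k hk l hl hkl
    by_contra hne
    have h := hsep k hk l hl hne
    have hk1 := Nat.floor_le (zero_le_one.trans (hx k hk))
    have hl1 := Nat.floor_le (zero_le_one.trans (hx l hl))
    have hk2 := Nat.lt_floor_add_one (x k)
    have hl2 := Nat.lt_floor_add_one (x l)
    simp only at hkl
    rw [hkl] at hk1 hk2
    exact absurd h (not_le.mpr (abs_lt.mpr ⟨by linarith, by linarith⟩))
  calc ∑ k ∈ s, (x k)⁻¹ ^ 2 ≤ ∑ k ∈ s, (1 : ℝ) / (⌊x k⌋₊ : ℝ) ^ 2 := by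
        refine sum_le_sum fun k hk => ?_
        have h1 : (1 : ℝ) ≤ ⌊x k⌋₊ := by
          exact_mod_cast (Nat.one_le_floor_iff (x k)).mpr (hx k hk)
        have h2 := Nat.floor_le (zero_le_one.trans (hx k hk))
        rw [inv_pow, ← one_div]
        gcongr
    _ = ∑ n ∈ s.image fun k => ⌊x k⌋₊, (1 : ℝ) / (n : ℝ) ^ 2 := by
        rw [sum_image hinj]
    _ ≤ Real.pi ^ 2 / 6 := sum_le_hasSum _ (fun _ _ => by positivity) hasSum_zeta_two

variable {lam : ι → ℝ}

/-- Partial fractions for `1 / ((λₖ - λₗ)(λₖ - λₘ))`, valid also on the diagonals, where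
`0⁻¹ = 0`. -/
lemma inv_sub_mul_inv_sub [DecidableEq ι] (hlam : Function.Injective lam) (k l m : ι) :
    (lam k - lam l)⁻¹ * (lam k - lam m)⁻¹
      = (lam l - lam m)⁻¹ * ((lam k - lam l)⁻¹ - (lam k - lam m)⁻¹)
        + ((if k = l then (lam l - lam m)⁻¹ ^ 2 else 0)
          + if k = m then (lam l - lam m)⁻¹ ^ 2 else 0)
        + if l = m then (lam k - lam l)⁻¹ ^ 2 else 0 := by
  rcases eq_or_ne l m with rfl | hlm
  · simp [sq]
  rcases eq_or_ne k l with rfl | hkl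
  · simp [hlm, sq]
  rcases eq_or_ne k m with rfl | hkm
  · rw [← neg_sub (lam k) (lam l), inv_neg]
    simp [hlm, hkl, sq]
  have h1 : lam l - lam m ≠ 0 := sub_ne_zero.mpr (hlam.ne hlm)
  have h2 : lam k - lam l ≠ 0 := sub_ne_zero.mpr (hlam.ne hkl)
  have h3 : lam k - lam m ≠ 0 := sub_ne_zero.mpr (hlam.ne hkm)
  simp only [hlm, hkl, hkm, if_false]
  field_simp
  ring

variable [Fintype ι]

/-- The term `k = l` vanishes because `0⁻¹ = 0`. -/
lemma sum_inv_sub_sq_le (hsep : ∀ k l, k ≠ l → 1 ≤ |lam k - lam l|) (l : ι) :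
    ∑ k, (lam k - lam l)⁻¹ ^ 2 ≤ Real.pi ^ 2 / 3 := by
  classical
  have habs : ∀ k, 0 < lam k - lam l → 1 ≤ lam k - lam l := fun k hk => by
    simpa [abs_of_pos hk] using hsep k l (by rintro rfl; simp at hk)
  have habs' : ∀ k, lam k - lam l < 0 → 1 ≤ lam l - lam k := fun k hk => by
    simpa [abs_of_neg hk] using hsep k l (by rintro rfl; simp at hk)
  have hpos : ∑ k with 0 < lam k - lam l, (lam k - lam l)⁻¹ ^ 2 ≤ Real.pi ^ 2 / 6 :=
    sum_inv_sq_le_of_one_le (fun k hk => habs k (mem_filter.mp hk).2)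
      fun k _ m _ hkm => by simpa using hsep k m hkm
  have hneg : ∑ k with lam k - lam l < 0, (lam l - lam k)⁻¹ ^ 2 ≤ Real.pi ^ 2 / 6 :=
    sum_inv_sq_le_of_one_le (fun k hk => habs' k (mem_filter.mp hk).2)
      fun k _ m _ hkm => by simpa using hsep m k hkm.symm
  rw [sum_filter] at hpos hneg
  calc ∑ k, (lam k - lam l)⁻¹ ^ 2
      = ∑ k, ((if 0 < lam k - lam l then (lam k - lam l)⁻¹ ^ 2 else 0)
          + if lam k - lam l < 0 then (lam l - lam k)⁻¹ ^ 2 else 0) := by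
        refine sum_congr rfl fun k _ => ?_
        rcases lt_trichotomy (lam k - lam l) 0 with h | h | h
        · rw [if_neg h.not_gt, if_pos h, ← neg_sub (lam k), inv_neg, neg_sq, zero_add]
        · simp [h]
        · rw [if_pos h, if_neg h.not_gt, add_zero]
    _ ≤ Real.pi ^ 2 / 3 := by rw [sum_add_distrib]; linarith

/-- For an eigenvector `v` of the skew-symmetric matrix `(1 / (λₖ - λₗ))`, the squared norm of its
image only involves the kernel `1 / (λₖ - λₗ)²`. -/
lemma sum_norm_sq_eq_of_eigenvector (hlam : Function.Injective lam) {v : ι → ℂ} {c : ℂ}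
    (hc : conj c = -c) (hv : ∀ k, ∑ l, ((lam k - lam l)⁻¹ : ℝ) * v l = c * v k) :
    ∑ k, (c * v k) * conj (c * v k)
      = ∑ l, ((∑ k, (lam k - lam l)⁻¹ ^ 2 : ℝ) : ℂ) * (v l * conj (v l))
        + 2 * ∑ l, ∑ m, (((lam l - lam m)⁻¹ ^ 2 : ℝ) : ℂ) * (v l * conj (v m)) := by
  classical
  set w : ι → ι → ℝ := fun k l => (lam k - lam l)⁻¹ with hw
  set S : ι → ℝ := fun l => ∑ k, w k l with hS
  have hsum : ∀ l m, ∑ k, w k l * w k m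
      = w l m * (S l - S m) + 2 * w l m ^ 2 + if l = m then ∑ k, w k l ^ 2 else 0 := by
    intro l m
    simp only [hw, hS, inv_sub_mul_inv_sub hlam, sum_add_distrib, ← mul_sum, sum_sub_distrib]
    rcases eq_or_ne l m with rfl | h
    · simp
    · simp [h, two_mul]
  have hrow : ∀ l, ∑ m, (w l m : ℂ) * conj (v m) = -c * conj (v l) := by
    intro l
    simpa [hw, hc] using congrArg conj (hv l)
  have hcol : ∀ m, ∑ l, (w l m : ℂ) * v l = -c * v m := by
    intro m
    rw [neg_mul, ← hv m, ← sum_neg_distrib]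
    refine sum_congr rfl fun l _ => ?_
    simp only [hw]
    rw [← neg_sub (lam m), inv_neg]
    push_cast
    ring
  have hcancel : ∑ l, ∑ m, ((w l m * (S l - S m) : ℝ) : ℂ) * (v l * conj (v m)) = 0 := by
    have h1 : ∑ l, ∑ m, (w l m : ℂ) * S l * (v l * conj (v m))
        = ∑ l, S l * v l * (-c * conj (v l)) := by
      refine sum_congr rfl fun l _ => ?_
      rw [← hrow l, mul_sum]
      exact sum_congr rfl fun m _ => by ring
    have h2 : ∑ l, ∑ m, (w l m : ℂ) * S m * (v l * conj (v m))
        = ∑ m, S m * conj (v m) * (-c * v m) := by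
      rw [sum_comm]
      refine sum_congr rfl fun m _ => ?_
      rw [← hcol m, mul_sum]
      exact sum_congr rfl fun l _ => by ring
    have h3 : ∀ l m, ((w l m * (S l - S m) : ℝ) : ℂ) * (v l * conj (v m))
        = (w l m : ℂ) * S l * (v l * conj (v m)) - (w l m : ℂ) * S m * (v l * conj (v m)) := by
      intro l m
      push_cast
      ring
    simp only [h3, sum_sub_distrib]
    rw [h1, h2, ← sum_sub_distrib]
    exact sum_eq_zero fun l _ => by ring
  calc ∑ k, (c * v k) * conj (c * v k)
      = ∑ k, ∑ l, ∑ m, ((w k l * w k m : ℝ) : ℂ) * (v l * conj (v m)) := by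
        refine sum_congr rfl fun k _ => ?_
        rw [← hv k, map_sum, sum_mul_sum]
        refine sum_congr rfl fun l _ => sum_congr rfl fun m _ => ?_
        simp only [map_mul, Complex.conj_ofReal, hw]
        push_cast
        ring
    _ = ∑ l, ∑ m, ((∑ k, w k l * w k m : ℝ) : ℂ) * (v l * conj (v m)) := by
        rw [sum_comm]
        refine sum_congr rfl fun l _ => ?_
        rw [sum_comm]
        refine sum_congr rfl fun m _ => ?_
        rw [Complex.ofReal_sum, sum_mul]
    _ = ∑ l, ∑ m, (((w l m * (S l - S m) : ℝ) : ℂ) * (v l * conj (v m))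
          + 2 * (((w l m ^ 2 : ℝ) : ℂ) * (v l * conj (v m)))
          + if l = m then ((∑ k, w k l ^ 2 : ℝ) : ℂ) * (v l * conj (v m)) else 0) := by
        refine sum_congr rfl fun l _ => sum_congr rfl fun m _ => ?_
        rw [hsum]
        split_ifs <;> push_cast <;> ring
    _ = _ := by
        simp only [sum_add_distrib, hcancel, ← mul_sum, sum_ite_eq, mem_univ, if_true]
        ring

lemma norm_le_pi_of_eigenvector (hsep : ∀ k l, k ≠ l → 1 ≤ |lam k - lam l|) {v : ι → ℂ} {c : ℂ}
    (hc : conj c = -c) (hv : ∀ k, ∑ l, ((lam k - lam l)⁻¹ : ℝ) * v l = c * v k)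
    (hne : v ≠ 0) : ‖c‖ ≤ Real.pi := by
  have hlam : Function.Injective lam := by
    intro k l hkl
    by_contra hne
    have := hsep k l hne
    norm_num [hkl] at this
  have hvpos : 0 < ∑ k, ‖v k‖ ^ 2 := by
    obtain ⟨k, hk⟩ := Function.ne_iff.mp hne
    exact sum_pos' (fun _ _ => by positivity) ⟨k, mem_univ k, by simpa [sq_pos_iff] using hk⟩
  have hsymm : ∀ l m, (lam l - lam m)⁻¹ ^ 2 = (lam m - lam l)⁻¹ ^ 2 := fun l m => by
    rw [← neg_sub, inv_neg, neg_sq]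
  have hbound : ∀ l, (∑ k, (lam k - lam l)⁻¹ ^ 2) * ‖v l‖ ^ 2
      ≤ Real.pi ^ 2 / 3 * ‖v l‖ ^ 2 := fun l => by
    gcongr
    exact sum_inv_sub_sq_le hsep l
  have hoff : ∑ l, ∑ m, (lam l - lam m)⁻¹ ^ 2 * (‖v l‖ * ‖v m‖)
      ≤ ∑ l, (∑ k, (lam k - lam l)⁻¹ ^ 2) * ‖v l‖ ^ 2 := by
    have h1 : ∑ l, ∑ m, (lam l - lam m)⁻¹ ^ 2 * ‖v l‖ ^ 2
        = ∑ l, (∑ k, (lam k - lam l)⁻¹ ^ 2) * ‖v l‖ ^ 2 := by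
      simp only [sum_mul, hsymm]
    have h2 : ∑ l, ∑ m, (lam l - lam m)⁻¹ ^ 2 * ‖v m‖ ^ 2
        = ∑ l, (∑ k, (lam k - lam l)⁻¹ ^ 2) * ‖v l‖ ^ 2 := by
      rw [sum_comm]
      simp only [sum_mul]
    calc ∑ l, ∑ m, (lam l - lam m)⁻¹ ^ 2 * (‖v l‖ * ‖v m‖)
        ≤ ∑ l, ∑ m, ((lam l - lam m)⁻¹ ^ 2 * ‖v l‖ ^ 2 / 2
            + (lam l - lam m)⁻¹ ^ 2 * ‖v m‖ ^ 2 / 2) := by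
          refine sum_le_sum fun l _ => sum_le_sum fun m _ => ?_
          nlinarith [mul_nonneg (sq_nonneg (lam l - lam m)⁻¹) (sq_nonneg (‖v l‖ - ‖v m‖))]
      _ = _ := by
          simp only [sum_add_distrib, ← sum_div]
          rw [h1, h2]
          ring
  have hmain : ‖c‖ ^ 2 * ∑ k, ‖v k‖ ^ 2 ≤ Real.pi ^ 2 * ∑ k, ‖v k‖ ^ 2 := by
    have heq := sum_norm_sq_eq_of_eigenvector hlam hc hv
    have hleft : ∑ k, (c * v k) * conj (c * v k) = ((‖c‖ ^ 2 * ∑ k, ‖v k‖ ^ 2 : ℝ) : ℂ) := by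
      simp only [Complex.mul_conj', norm_mul, mul_sum]
      push_cast
      simp only [mul_pow]
    calc ‖c‖ ^ 2 * ∑ k, ‖v k‖ ^ 2
        = ‖((‖c‖ ^ 2 * ∑ k, ‖v k‖ ^ 2 : ℝ) : ℂ)‖ := by
          rw [Complex.norm_real, Real.norm_of_nonneg (by positivity)]
      _ ≤ ∑ l, (∑ k, (lam k - lam l)⁻¹ ^ 2) * ‖v l‖ ^ 2
          + 2 * ∑ l, ∑ m, (lam l - lam m)⁻¹ ^ 2 * (‖v l‖ * ‖v m‖) := by
          rw [← hleft, heq]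
          refine (norm_add_le _ _).trans (add_le_add ?_ ?_)
          · refine norm_sum_le_of_le _ fun l _ => le_of_eq ?_
            rw [norm_mul, norm_mul, RCLike.norm_conj, Complex.norm_real,
              Real.norm_of_nonneg (sum_nonneg fun _ _ => sq_nonneg _), sq ‖v l‖]
          · rw [norm_mul, Complex.norm_ofNat]
            gcongr
            refine norm_sum_le_of_le _ fun l _ => norm_sum_le_of_le _ fun m _ => le_of_eq ?_
            rw [norm_mul, norm_mul, RCLike.norm_conj, Complex.norm_real,
              Real.norm_of_nonneg (sq_nonneg _)]
      _ ≤ 3 * ∑ l, (∑ k, (lam k - lam l)⁻¹ ^ 2) * ‖v l‖ ^ 2 := by linarith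
      _ ≤ 3 * ∑ l, Real.pi ^ 2 / 3 * ‖v l‖ ^ 2 := by
          gcongr 3 * ?_
          exact sum_le_sum fun l _ => hbound l
      _ = Real.pi ^ 2 * ∑ k, ‖v k‖ ^ 2 := by
          rw [← mul_sum]
          ring
  exact (sq_le_sq₀ (norm_nonneg c) Real.pi_pos.le).mp (le_of_mul_le_mul_right hmain hvpos)

/-- Hilbert's inequality in the form of Montgomery and Vaughan. -/
theorem hilbert_inequality (hsep : ∀ k l, k ≠ l → 1 ≤ |lam k - lam l|) (a : ι → ℂ) :
    (∑ k, ∑ l, a k * conj (a l) * (Complex.I * ((lam k - lam l)⁻¹ : ℝ))).re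
      ≤ Real.pi * ∑ k, ‖a k‖ ^ 2 := by
  classical
  let B : Matrix ι ι ℂ := (Real.pi : ℂ) • (1 : Matrix ι ι ℂ)
    - Matrix.of fun k l => Complex.I * ((lam k - lam l)⁻¹ : ℝ)
  have hB : B.IsHermitian := by
    ext k l
    rcases eq_or_ne k l with rfl | h
    · simp [B]
    · simp only [B, Matrix.conjTranspose_apply, Matrix.sub_apply, Matrix.smul_apply,
        Matrix.one_apply_ne h, Matrix.one_apply_ne h.symm, Matrix.of_apply]
      rw [← neg_sub (lam k), inv_neg]
      simp
  have hBv : ∀ (x : ι → ℂ) k, B.mulVec x k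
      = Real.pi * x k - Complex.I * ∑ l, ((lam k - lam l)⁻¹ : ℝ) * x l := by
    intro x k
    rw [Matrix.sub_mulVec, Matrix.smul_mulVec, Matrix.one_mulVec]
    simp [Matrix.mulVec, dotProduct, mul_sum, mul_assoc]
  have hpsd : B.PosSemidef := by
    rw [hB.posSemidef_iff_eigenvalues_nonneg]
    intro j
    set ν := hB.eigenvalues j with hν
    set v : ι → ℂ := ⇑(hB.eigenvectorBasis j) with hvdef
    have hne : v ≠ 0 := by
      intro h
      exact hB.eigenvectorBasis.orthonormal.ne_zero j (by ext k; exact congrFun h k)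
    have hc : conj (Complex.I * ((ν - Real.pi : ℝ) : ℂ))
        = -(Complex.I * ((ν - Real.pi : ℝ) : ℂ)) := by
      simp
    have hv : ∀ k, ∑ l, ((lam k - lam l)⁻¹ : ℝ) * v l
        = Complex.I * ((ν - Real.pi : ℝ) : ℂ) * v k := by
      intro k
      have h := congrFun (hB.mulVec_eigenvectorBasis j) k
      rw [← hvdef, hBv, ← hν] at h
      simp only [Pi.smul_apply, Complex.real_smul] at h
      push_cast at h ⊢
      linear_combination Complex.I * h
        + (∑ l, ((lam k : ℂ) - lam l)⁻¹ * v l) * Complex.I_sq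
    have := norm_le_pi_of_eigenvector hsep hc hv hne
    rw [norm_mul, Complex.norm_I, one_mul, Complex.norm_real, Real.norm_eq_abs] at this
    have := (abs_le.mp this).1
    simp only [Pi.zero_apply]
    linarith
  have h := hpsd.re_dotProduct_nonneg (fun k => conj (a k))
  have heq : star (fun k => conj (a k)) ⬝ᵥ B.mulVec (fun k => conj (a k))
      = ((Real.pi * ∑ k, ‖a k‖ ^ 2 : ℝ) : ℂ)
        - ∑ k, ∑ l, a k * conj (a l) * (Complex.I * ((lam k - lam l)⁻¹ : ℝ)) := by
    simp only [dotProduct, hBv, Pi.star_apply, RCLike.star_def, Complex.conj_conj, mul_sub,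
      sum_sub_distrib]
    congr 1
    · push_cast
      rw [mul_sum]
      refine sum_congr rfl fun k _ => ?_
      rw [← Complex.mul_conj']
      ring
    · simp only [mul_sum]
      refine sum_congr rfl fun k _ => sum_congr rfl fun l _ => ?_
      ring
  rw [heq] at h
  simp only [RCLike.re_to_complex, Complex.sub_re, Complex.ofReal_re] at h
  linarith

end HilbertInequality

lemma integral_exp_neg_two_pi_mul {L : ℝ} {x : ℝ} (hx : x ≠ 0) :
    ∫ t in (-(L/2))..(L/2), Complex.exp (-(((2 * Real.pi * x * t : ℝ) : ℂ) * Complex.I))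
      = (2 * Real.pi : ℂ)⁻¹ * (Complex.I * (x⁻¹ : ℝ)
        * (Complex.exp (-((Real.pi * L * x : ℝ) * Complex.I))
          - Complex.exp ((Real.pi * L * x : ℝ) * Complex.I))) := by
  have hx' : (x : ℂ) ≠ 0 := by exact_mod_cast hx
  have hpi : (Real.pi : ℂ) ≠ 0 := by exact_mod_cast Real.pi_ne_zero
  have hc : -(2 * Real.pi * x * Complex.I) ≠ 0 := by
    simp [hx', hpi]
  have h := integral_exp_mul_complex (a := -(L/2)) (b := L/2) hc
  have hfun : ∀ t : ℝ, Complex.exp (-(((2 * Real.pi * x * t : ℝ) : ℂ) * Complex.I))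
      = Complex.exp (-(2 * Real.pi * x * Complex.I) * t) := fun t => by
    congr 1
    push_cast
    ring
  simp only [hfun, h]
  have e1 : -(2 * Real.pi * x * Complex.I) * ((L/2 : ℝ) : ℂ)
      = -((Real.pi * L * x : ℝ) * Complex.I) := by push_cast; ring
  have e2 : -(2 * Real.pi * x * Complex.I) * ((-(L/2) : ℝ) : ℂ)
      = (Real.pi * L * x : ℝ) * Complex.I := by push_cast; ring
  rw [e1, e2, div_eq_iff hc]
  push_cast
  field_simp
  rw [Complex.I_sq]
  ring

open ComplexConjugate in
/-- Upper L² bound over a finite interval for a unimodular exponential sum with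
1-separated frequencies. -/
theorem exp_sum_L2_upper (N : ℕ) (lam : Fin N → ℝ)
    (hsep : ∀ k l : Fin N, k ≠ l → 1 ≤ |lam k - lam l|)
    (u : Fin N → ℂ) (hu : ∀ k, ‖u k‖ = 1) (L : ℝ) (hL : 0 < L) :
    ∫ t in (-(L/2))..(L/2),
        ‖∑ k : Fin N, u k * Complex.exp (-(((2 * Real.pi * lam k * t : ℝ) : ℂ) * Complex.I))‖ ^ 2
      ≤ (L + 1) * N := by
  set a : Fin N → ℂ := fun k => u k * Complex.exp (-((Real.pi * L * lam k : ℝ) * Complex.I))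
  set b : Fin N → ℂ := fun k => u k * Complex.exp ((Real.pi * L * lam k : ℝ) * Complex.I)
  have hconj : ∀ x : ℝ, conj (Complex.exp (x * Complex.I)) = Complex.exp (-(x * Complex.I)) := by
    intro x
    rw [← Complex.exp_conj]
    simp
  have hconj' : ∀ x : ℝ, conj (Complex.exp (-(x * Complex.I))) = Complex.exp (x * Complex.I) := by
    intro x
    rw [← Complex.exp_conj]
    simp
  have ha : ∑ k, ‖a k‖ ^ 2 = N := by
    simp [a, hu, Complex.norm_exp]
  have hb : ∑ k, ‖b k‖ ^ 2 = N := by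
    simp [b, hu, Complex.norm_exp]
  have hA := hilbert_inequality hsep a
  have hB := hilbert_inequality (lam := fun k => -lam k)
    (fun k l hkl => by
      simpa [neg_add_eq_sub] using hsep l k hkl.symm) b
  rw [ha] at hA
  rw [hb] at hB
  have hterm : ∀ k l, ∫ t in (-(L/2))..(L/2), u k * conj (u l)
        * Complex.exp (-(((2 * Real.pi * (lam k - lam l) * t : ℝ) : ℂ) * Complex.I))
      = (if k = l then (L : ℂ) else 0)
        + (2 * Real.pi : ℂ)⁻¹ * (a k * conj (a l) * (Complex.I * ((lam k - lam l)⁻¹ : ℝ))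
          + b k * conj (b l) * (Complex.I * ((-lam k - -lam l)⁻¹ : ℝ))) := by
    intro k l
    rcases eq_or_ne k l with rfl | hkl
    · simp [Complex.mul_conj', hu]
    have hne : lam k - lam l ≠ 0 := by
      intro h
      have := hsep k l hkl
      norm_num [h] at this
    have e1 : Complex.exp (-((Real.pi * L * (lam k - lam l) : ℝ) * Complex.I))
        = Complex.exp (-((Real.pi * L * lam k : ℝ) * Complex.I))
          * Complex.exp ((Real.pi * L * lam l : ℝ) * Complex.I) := by
      rw [← Complex.exp_add]
      congr 1
      push_cast
      ring
    have e2 : Complex.exp ((Real.pi * L * (lam k - lam l) : ℝ) * Complex.I)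
        = Complex.exp ((Real.pi * L * lam k : ℝ) * Complex.I)
          * Complex.exp (-((Real.pi * L * lam l : ℝ) * Complex.I)) := by
      rw [← Complex.exp_add]
      congr 1
      push_cast
      ring
    have e3 : (-lam k - -lam l)⁻¹ = -(lam k - lam l)⁻¹ := by
      rw [← inv_neg]
      congr 1
      ring
    rw [intervalIntegral.integral_const_mul, integral_exp_neg_two_pi_mul hne, e1, e2, e3,
      if_neg hkl]
    simp only [a, b, map_mul, hconj, hconj', Complex.ofReal_neg]
    ring
  have hexpand : ∀ t : ℝ, ((‖∑ k : Fin N,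
        u k * Complex.exp (-(((2 * Real.pi * lam k * t : ℝ) : ℂ) * Complex.I))‖ ^ 2 : ℝ) : ℂ)
      = ∑ k, ∑ l, u k * conj (u l)
        * Complex.exp (-(((2 * Real.pi * (lam k - lam l) * t : ℝ) : ℂ) * Complex.I)) := by
    intro t
    rw [Complex.ofReal_pow, ← Complex.mul_conj', map_sum, Finset.sum_mul_sum]
    refine Finset.sum_congr rfl fun k _ => Finset.sum_congr rfl fun l _ => ?_
    have e : Complex.exp (-(((2 * Real.pi * (lam k - lam l) * t : ℝ) : ℂ) * Complex.I))
        = Complex.exp (-(((2 * Real.pi * lam k * t : ℝ) : ℂ) * Complex.I))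
          * Complex.exp (((2 * Real.pi * lam l * t : ℝ) : ℂ) * Complex.I) := by
      rw [← Complex.exp_add]
      congr 1
      push_cast
      ring
    rw [map_mul, hconj', e]
    ring
  have hint : ((∫ t in (-(L/2))..(L/2), ‖∑ k : Fin N,
        u k * Complex.exp (-(((2 * Real.pi * lam k * t : ℝ) : ℂ) * Complex.I))‖ ^ 2 : ℝ) : ℂ)
      = ((L * N : ℝ) : ℂ) + (((2 * Real.pi)⁻¹ : ℝ) : ℂ)
        * (∑ k, ∑ l, a k * conj (a l) * (Complex.I * ((lam k - lam l)⁻¹ : ℝ))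
          + ∑ k, ∑ l, b k * conj (b l) * (Complex.I * ((-lam k - -lam l)⁻¹ : ℝ))) := by
    rw [← intervalIntegral.integral_ofReal]
    simp only [hexpand]
    rw [intervalIntegral.integral_finsetSum
      fun k _ => Continuous.intervalIntegrable (by fun_prop) _ _]
    have hinner : ∀ k, ∫ t in (-(L/2))..(L/2), ∑ l, u k * conj (u l)
          * Complex.exp (-(((2 * Real.pi * (lam k - lam l) * t : ℝ) : ℂ) * Complex.I))
        = ∑ l, ∫ t in (-(L/2))..(L/2), u k * conj (u l)
          * Complex.exp (-(((2 * Real.pi * (lam k - lam l) * t : ℝ) : ℂ) * Complex.I)) :=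
      fun k => intervalIntegral.integral_finsetSum
        fun l _ => Continuous.intervalIntegrable (by fun_prop) _ _
    simp only [hinner, hterm, Finset.sum_add_distrib, ← Finset.mul_sum, Finset.sum_ite_eq,
      Finset.mem_univ, if_true, Finset.sum_const, Finset.card_univ, Fintype.card_fin, nsmul_eq_mul]
    push_cast
    ring
  have hre := congrArg Complex.re hint
  rw [Complex.add_re, Complex.re_ofReal_mul, Complex.add_re, Complex.ofReal_re,
    Complex.ofReal_re] at hre
  rw [hre]
  calc L * N + (2 * Real.pi)⁻¹ * (_ + _)
      ≤ L * N + (2 * Real.pi)⁻¹ * (Real.pi * N + Real.pi * N) := by gcongr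
    _ = (L + 1) * N := by
        have := Real.pi_ne_zero
        field_simp
        ring
end

section
/- Let H be a function in L²(I) on an interval I of length L whose Fourier series has only nonnegative-frequency terms (c_s(H) = 0 for s < 0) and whose real part satisfies Re(H) ≥ 0 a.e. Then for every η > 0, the function e^{-ηH} − 1 has vanishing negative Fourier coefficients and ‖e^{-ηH} − 1‖_{L²(I)} ≤ η ‖H‖_{L²(I)}. -/
open MeasureTheory intervalIntegral

theorem norm_exp_neg_sub_exp_neg_le {z w : ℂ} (hz : 0 ≤ z.re) (hw : 0 ≤ w.re) :
    ‖Complex.exp (-z) - Complex.exp (-w)‖ ≤ ‖z - w‖ := by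
  have h := Convex.norm_image_sub_le_of_norm_hasDerivWithin_le (𝕜 := ℂ)
    (f := fun u : ℂ => Complex.exp (-u)) (f' := fun u => Complex.exp (-u) * -1)
    (s := {u | 0 ≤ u.re}) (C := 1) (x := w) (y := z)
    (fun u _ => ((hasDerivAt_neg u).cexp).hasDerivWithinAt)
    (fun u hu => by simpa [Complex.norm_exp] using hu) (convex_halfSpace_re_ge 0) hw hz
  simpa using h

section Circle

open Filter Topology AddCircle ComplexConjugate

theorem fourier_one_pow {T : ℝ} (n : ℕ) : (fourier 1 : C(AddCircle T, ℂ)) ^ n = fourier n := by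
  induction n with
  | zero => ext x; simp
  | succ n ih =>
    ext x
    rw [pow_succ, ih, Nat.cast_succ, ContinuousMap.mul_apply, fourier_add]

variable {T : ℝ} [hT : Fact (0 < T)]

/-- The closed algebra of continuous functions on the circle generated by `fourier 1`. -/
noncomputable def analyticSubalgebra (T : ℝ) [Fact (0 < T)] : Subalgebra ℂ C(AddCircle T, ℂ) :=
  (Algebra.adjoin ℂ {fourier 1}).topologicalClosure

theorem fourier_mem_analyticSubalgebra (n : ℕ) :
    (fourier n : C(AddCircle T, ℂ)) ∈ analyticSubalgebra T := by
  rw [← fourier_one_pow]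
  exact pow_mem (Subalgebra.le_topologicalClosure _ (Algebra.self_mem_adjoin_singleton _ _)) n

theorem exists_clm_eq_fourierCoeff (s : ℤ) :
    ∃ φ : C(AddCircle T, ℂ) →L[ℂ] ℂ, ∀ g : C(AddCircle T, ℂ), φ g = fourierCoeff g s := by
  refine ⟨(innerSL ℂ (fourierBasis s : Lp ℂ 2 (@haarAddCircle T hT))).comp
    (ContinuousMap.toLp (E := ℂ) 2 haarAddCircle ℂ), fun g => ?_⟩
  rw [← fourierCoeff_toLp, ← fourierBasis_repr, HilbertBasis.repr_apply_apply]
  rfl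

theorem fourierCoeff_eq_zero_of_mem_analyticSubalgebra {f : C(AddCircle T, ℂ)}
    (hf : f ∈ analyticSubalgebra T) {s : ℤ} (hs : s < 0) : fourierCoeff f s = 0 := by
  obtain ⟨φ, hφ⟩ := exists_clm_eq_fourierCoeff (T := T) s
  have hspan : Submodule.span ℂ
      ((Submonoid.closure {fourier 1} : Submonoid C(AddCircle T, ℂ)) : Set _) ≤ φ.ker := by
    refine Submodule.span_le.2 fun k hk => ?_
    obtain ⟨n, rfl⟩ := Submonoid.mem_closure_singleton.1 hk
    rw [SetLike.mem_coe, LinearMap.mem_ker, ContinuousLinearMap.coe_coe, hφ, fourier_one_pow,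
      fourierCoeff_fourier, Pi.single_eq_of_ne (by omega)]
  have hadjoin : ((Algebra.adjoin ℂ {fourier 1} : Subalgebra ℂ C(AddCircle T, ℂ)) : Set _) ⊆
      (φ.ker : Set C(AddCircle T, ℂ)) := by
    rw [← Subalgebra.coe_toSubmodule, Algebra.adjoin_eq_span]
    exact hspan
  have hmem : f ∈ closure
      ((Algebra.adjoin ℂ {fourier 1} : Subalgebra ℂ C(AddCircle T, ℂ)) : Set _) := by
    rw [← Subalgebra.topologicalClosure_coe]
    exact hf
  rw [← hφ]
  exact closure_minimal hadjoin φ.isClosed_ker hmem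

theorem exp_neg_sub_one_mem_analyticSubalgebra {f : C(AddCircle T, ℂ)}
    (hf : f ∈ analyticSubalgebra T) :
    NormedSpace.exp (-f) - 1 ∈ analyticSubalgebra T :=
  sub_mem (NormedSpace.exp_mem (R := ℂ) (Subalgebra.isClosed_topologicalClosure _)
    (neg_mem hf)) (one_mem _)

/-- The Fejér mean of order `N` of the Fourier series of `f`. -/
noncomputable def fejerMean (f : AddCircle T → ℂ) (N : ℕ) : C(AddCircle T, ℂ) :=
  (N⁻¹ : ℝ) • ∑ j ∈ Finset.range N, ∑ k ∈ Finset.range N,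
    fourierCoeff f (j - k) • fourier (j - k)

theorem re_fejerMean_nonneg {f : AddCircle T → ℂ} (hf : Integrable f haarAddCircle)
    (hre : ∀ᵐ x ∂haarAddCircle, 0 ≤ (f x).re) (N : ℕ) (x : AddCircle T) :
    0 ≤ (fejerMean f N x).re := by
  let g (u : AddCircle T) (j : ℕ) : ℂ := fourier j x * conj (fourier j u)
  have hker (u : AddCircle T) :
      ∑ j ∈ Finset.range N, ∑ k ∈ Finset.range N,
        fourier (-((j : ℤ) - k)) u • f u * fourier ((j : ℤ) - k) x =
      (‖∑ j ∈ Finset.range N, g u j‖ ^ 2 : ℝ) * f u := by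
    rw [Complex.ofReal_pow, ← Complex.mul_conj', map_sum, Finset.sum_mul_sum, Finset.sum_mul]
    refine Finset.sum_congr rfl fun j _ => ?_
    rw [Finset.sum_mul]
    refine Finset.sum_congr rfl fun k _ => ?_
    simp only [g, smul_eq_mul, sub_eq_add_neg, fourier_add, fourier_neg, neg_add_rev, neg_neg,
      map_mul, Complex.conj_conj]
    ring
  have hint (j k : ℕ) : Integrable
      (fun u => fourier (-((j : ℤ) - k)) u • f u * fourier ((j : ℤ) - k) x) haarAddCircle :=
    (hf.fourier_smul _).mul_const _
  have hsum : fejerMean f N x =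
      (N⁻¹ : ℝ) • ∫ u, ((‖∑ j ∈ Finset.range N, g u j‖ ^ 2 : ℝ) : ℂ) * f u ∂haarAddCircle := by
    simp_rw [← hker]
    rw [integral_finsetSum _ fun j _ => integrable_finsetSum _ fun k _ => hint j k]
    simp_rw [integral_finsetSum _ fun k _ => hint _ k, MeasureTheory.integral_mul_const]
    simp [fejerMean, fourierCoeff, -fourier_apply]
  have hI : Integrable (fun u => ((‖∑ j ∈ Finset.range N, g u j‖ ^ 2 : ℝ) : ℂ) * f u)
      haarAddCircle := by
    simp_rw [← hker]
    exact integrable_finsetSum _ fun j _ => integrable_finsetSum _ fun k _ => hint j k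
  rw [hsum, Complex.real_smul, Complex.re_ofReal_mul]
  refine mul_nonneg (by positivity) ?_
  have hre' := integral_re hI
  simp only [RCLike.re_eq_complex_re] at hre'
  rw [← hre']
  refine integral_nonneg_of_ae ?_
  filter_upwards [hre] with u hu
  simp only [Complex.re_ofReal_mul, Pi.zero_apply]
  positivity

theorem fejerMean_eq_of_fourierCoeff_neg_eq_zero {f : AddCircle T → ℂ}
    (hf : ∀ s : ℤ, s < 0 → fourierCoeff f s = 0) (N : ℕ) :
    fejerMean f N = (N⁻¹ : ℝ) • ∑ j ∈ Finset.range N, ∑ m ∈ Finset.range (j + 1),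
      fourierCoeff f (m : ℤ) • fourier (m : ℤ) := by
  rw [fejerMean]
  congr 1
  refine Finset.sum_congr rfl fun j hj => ?_
  rw [Finset.mem_range] at hj
  rw [← Finset.sum_flip, ← Finset.sum_subset (Finset.range_subset_range.2 (Nat.succ_le_of_lt hj))]
  · refine Finset.sum_congr rfl fun k hk => ?_
    rw [Finset.mem_range] at hk
    rw [Nat.cast_sub (by omega)]
  · intro k _ hk
    rw [Finset.mem_range] at hk
    rw [hf _ (by omega), zero_smul]

theorem fejerMean_mem_analyticSubalgebra {f : AddCircle T → ℂ}
    (hf : ∀ s : ℤ, s < 0 → fourierCoeff f s = 0) (N : ℕ) :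
    fejerMean f N ∈ analyticSubalgebra T := by
  rw [fejerMean_eq_of_fourierCoeff_neg_eq_zero hf, ← Complex.coe_smul]
  exact Subalgebra.smul_mem _ (sum_mem fun j _ => sum_mem fun m _ =>
    Subalgebra.smul_mem _ (fourier_mem_analyticSubalgebra m) _) _

theorem tendsto_toLp_fejerMean {f : Lp ℂ 2 (@haarAddCircle T hT)}
    (hf : ∀ s : ℤ, s < 0 → fourierCoeff f s = 0) :
    Tendsto (fun N => ContinuousMap.toLp (E := ℂ) 2 haarAddCircle ℂ (fejerMean f N))
      atTop (𝓝 f) := by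
  have hsum : HasSum (fun m : ℕ => fourierCoeff f (m : ℤ) • fourierLp (T := T) 2 (m : ℤ)) f := by
    refine (Nat.cast_injective (R := ℤ)).hasSum_iff ?_ |>.2 (hasSum_fourier_series_L2 f)
    intro s hs
    rw [hf s, zero_smul]
    by_contra! h
    exact hs ⟨s.toNat, by simpa using h⟩
  have h := ((tendsto_add_atTop_iff_nat 1).2 hsum.tendsto_sum_nat).cesaro_smul
  refine h.congr fun N => ?_
  rw [fejerMean_eq_of_fourierCoeff_neg_eq_zero hf, ← Complex.coe_smul, map_smul,
    map_sum, Complex.coe_smul]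
  simp_rw [map_sum, map_smul]
  rfl

theorem memLp_exp_neg_sub_one {α : Type*} [MeasurableSpace α] {μ : Measure α}
    {p : ENNReal} {f : α → ℂ} (hf : MemLp f p μ) (hre : ∀ᵐ x ∂μ, 0 ≤ (f x).re) :
    MemLp (fun x => Complex.exp (-f x) - 1) p μ := by
  refine hf.mono ?_ ?_
  · exact (Complex.continuous_exp.comp_aestronglyMeasurable hf.1.neg).sub
      aestronglyMeasurable_const
  · filter_upwards [hre] with x hx
    simpa using norm_exp_neg_sub_exp_neg_le hx (w := 0) (by simp)

theorem fourierCoeff_exp_neg_sub_one_eq_zero {f : AddCircle T → ℂ}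
    (hf : MemLp f 2 haarAddCircle) (hneg : ∀ s : ℤ, s < 0 → fourierCoeff f s = 0)
    (hre : ∀ᵐ x ∂haarAddCircle, 0 ≤ (f x).re) {s : ℤ} (hs : s < 0) :
    fourierCoeff (fun x => Complex.exp (-f x) - 1) s = 0 := by
  have hE := memLp_exp_neg_sub_one hf hre
  have hcoe : fourierCoeff hf.toLp = fourierCoeff f := fourierCoeff_congr_ae hf.coeFn_toLp
  have hneg' : ∀ s : ℤ, s < 0 → fourierCoeff hf.toLp s = 0 := by rwa [hcoe]
  let P (N : ℕ) : C(AddCircle T, ℂ) := fejerMean hf.toLp N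
  let E (N : ℕ) : C(AddCircle T, ℂ) := NormedSpace.exp (-P N) - 1
  let ι := ContinuousMap.toLp (E := ℂ) 2 (@haarAddCircle T hT) ℂ
  have hre' : ∀ᵐ x ∂haarAddCircle, 0 ≤ ((hf.toLp : AddCircle T → ℂ) x).re := by
    filter_upwards [hre, hf.coeFn_toLp] with x hx h
    rwa [h]
  have hP (N : ℕ) (x : AddCircle T) : 0 ≤ (P N x).re :=
    re_fejerMean_nonneg ((Lp.memLp _).integrable (by norm_num)) hre' N x
  have hEx (N : ℕ) (x : AddCircle T) : E N x = Complex.exp (-P N x) - 1 := by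
    have h := NormedSpace.map_exp (ContinuousMap.evalAlgHom ℂ ℂ x)
      (ContinuousEvalConst.continuous_eval_const x) (-P N)
    simp only [E, ContinuousMap.sub_apply, ContinuousMap.one_apply]
    rw [Complex.exp_eq_exp_ℂ]
    exact congrArg (· - 1) h
  have hle (N : ℕ) : ‖ι (E N) - hE.toLp‖ ≤ ‖ι (P N) - hf.toLp‖ := by
    refine Lp.norm_le_norm_of_ae_le ?_
    filter_upwards [Lp.coeFn_sub (ι (E N)) hE.toLp, Lp.coeFn_sub (ι (P N)) hf.toLp,
      hE.coeFn_toLp, hf.coeFn_toLp, ContinuousMap.coeFn_toLp (p := 2) haarAddCircle (𝕜 := ℂ) (E N),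
      ContinuousMap.coeFn_toLp (p := 2) haarAddCircle (𝕜 := ℂ) (P N), hre]
      with x h1 h2 h3 h4 h5 h6 h7
    rw [h1, h2, Pi.sub_apply, Pi.sub_apply, h3, h4, h5, h6, hEx, sub_sub_sub_cancel_right]
    exact norm_exp_neg_sub_exp_neg_le (hP N x) h7
  have hlim : Tendsto (fun N => ι (E N)) atTop (𝓝 hE.toLp) := by
    rw [tendsto_iff_norm_sub_tendsto_zero]
    exact squeeze_zero (fun _ => norm_nonneg _) hle
      (tendsto_iff_norm_sub_tendsto_zero.1 (tendsto_toLp_fejerMean hneg'))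
  have hzero (N : ℕ) : inner ℂ (fourierBasis s) (ι (E N)) = 0 := by
    rw [← HilbertBasis.repr_apply_apply, fourierBasis_repr, fourierCoeff_toLp]
    exact fourierCoeff_eq_zero_of_mem_analyticSubalgebra
      (exp_neg_sub_one_mem_analyticSubalgebra (fejerMean_mem_analyticSubalgebra hneg' N)) hs
  rw [← fourierCoeff_congr_ae hE.coeFn_toLp, ← fourierBasis_repr, HilbertBasis.repr_apply_apply]
  refine tendsto_nhds_unique (tendsto_const_nhds.inner hlim) ?_
  simp_rw [hzero]
  exact tendsto_const_nhds

theorem fourierCoeff_liftIoc_eq_integral (A : ℝ) (f : ℝ → ℂ) (s : ℤ) :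
    fourierCoeff (liftIoc T A f) s = (1 / T : ℂ) * ∫ t in A..(A + T),
      f t * Complex.exp (-(((2 * Real.pi * s * t / T : ℝ) : ℂ) * Complex.I)) := by
  rw [fourierCoeff_eq_intervalIntegral _ _ A, Complex.real_smul]
  push_cast
  congr 1
  have hT0 := hT.out
  simp_rw [intervalIntegral.integral_of_le (by linarith : A ≤ A + T)]
  refine setIntegral_congr_fun measurableSet_Ioc fun t ht => ?_
  simp only [liftIoc_coe_apply ht, smul_eq_mul]
  rw [fourier_coe_apply, mul_comm]
  congr 2
  push_cast
  ring

theorem ae_liftIoc {A : ℝ} {f : ℝ → ℂ} {p : ℂ → Prop}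
    (h : ∀ᵐ t ∂volume.restrict (Set.Ioc A (A + T)), p (f t)) :
    ∀ᵐ x ∂(@haarAddCircle T hT), p (liftIoc T A f x) := by
  have hmp : MeasurePreserving (fun x => (equivIoc T A x : ℝ)) (volume : Measure (AddCircle T))
      (volume.restrict (Set.Ioc A (A + T))) :=
    (measurePreserving_subtype_coe measurableSet_Ioc).comp (measurePreserving_equivIoc T)
  have hvol := hmp.quasiMeasurePreserving.ae h
  rw [volume_eq_smul_haarAddCircle,
    Measure.ae_ennreal_smul_measure_iff (by simpa using hT.out)] at hvol
  exact hvol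

end Circle


/-- McGehee–Pigno–Smith key lemma on an interval `I` of length `L`: if `H ∈ L²(I)` has
no negative-frequency Fourier coefficients and `Re H ≥ 0` a.e., then for every `η > 0`
the function `e^{-ηH} - 1` also has no negative-frequency Fourier coefficients and
`‖e^{-ηH} - 1‖_{L²(I)} ≤ η ‖H‖_{L²(I)}`. -/
theorem mps_exponential_lemma (A L : ℝ) (hL : 0 < L) (H : ℝ → ℂ)
    (hH_int : IntegrableOn H (Set.Icc A (A + L)))
    (hH_sq : IntegrableOn (fun t => ‖H t‖ ^ 2) (Set.Icc A (A + L)))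
    (hH_neg : ∀ s : ℤ, s < 0 →
      (1 / L : ℂ) * ∫ t in A..(A + L),
          H t * Complex.exp (-(((2 * Real.pi * s * t / L : ℝ) : ℂ) * Complex.I)) = 0)
    (hH_re : ∀ᵐ t ∂(volume.restrict (Set.Icc A (A + L))), 0 ≤ (H t).re)
    (η : ℝ) (hη : 0 < η) :
    (∀ s : ℤ, s < 0 →
      (1 / L : ℂ) * ∫ t in A..(A + L),
          (Complex.exp (-(η : ℂ) * H t) - 1) *
            Complex.exp (-(((2 * Real.pi * s * t / L : ℝ) : ℂ) * Complex.I)) = 0) ∧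
    ∫ t in Set.Icc A (A + L), ‖Complex.exp (-(η : ℂ) * H t) - 1‖ ^ 2 ≤
      η ^ 2 * ∫ t in Set.Icc A (A + L), ‖H t‖ ^ 2 := by
  have : Fact (0 < L) := ⟨hL⟩
  have hIcc : volume.restrict (Set.Icc A (A + L)) = volume.restrict (Set.Ioc A (A + L)) :=
    restrict_Ioc_eq_restrict_Icc.symm
  have hmem : MemLp (fun t => (η : ℂ) * H t) 2 (volume.restrict (Set.Icc A (A + L))) :=
    ((memLp_two_iff_integrable_sq_norm hH_int.1).2 hH_sq).const_mul _
  have hre : ∀ᵐ t ∂volume.restrict (Set.Icc A (A + L)), 0 ≤ ((η : ℂ) * H t).re := by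
    filter_upwards [hH_re] with t ht
    rw [Complex.re_ofReal_mul]
    positivity
  refine ⟨fun s hs => ?_, ?_⟩
  · simp_rw [neg_mul]
    rw [← fourierCoeff_liftIoc_eq_integral]
    refine fourierCoeff_exp_neg_sub_one_eq_zero
      (f := AddCircle.liftIoc L A fun t => (η : ℂ) * H t) ?_ ?_ ?_ hs
    · rw [hIcc] at hmem
      exact hmem.memLp_liftIoc.haarAddCircle
    · intro r hr
      rw [fourierCoeff_liftIoc_eq_integral]
      simp_rw [mul_assoc (η : ℂ)]
      rw [intervalIntegral.integral_const_mul, mul_left_comm, hH_neg r hr, mul_zero]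
    · rw [hIcc] at hre
      exact ae_liftIoc (p := fun z => 0 ≤ z.re) hre
  · rw [← MeasureTheory.integral_const_mul]
    refine integral_mono_ae ?_ (hH_sq.const_mul _) ?_
    · simp_rw [neg_mul]
      exact (memLp_exp_neg_sub_one hmem hre).integrable_norm_pow two_ne_zero
    · filter_upwards [hre] with t ht
      have h := norm_exp_neg_sub_exp_neg_le ht (w := 0) (by simp)
      rw [neg_zero, Complex.exp_zero, sub_zero, norm_mul, Complex.norm_real,
        Real.norm_of_nonneg hη.le, ← neg_mul] at h
      rw [← mul_pow]
      gcongr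
end

section
/- Let λ_1, ..., λ_N be real numbers with |λ_k − λ_ℓ| ≥ 1 for k ≠ ℓ, let a_1, ..., a_N be complex numbers, and let T > 1. Then ∫_{-T/2}^{T/2} |∑_{k=1}^N a_k e^{2πi λ_k t}|² dt ≥ T · C(T) ∑_{k=1}^N |a_k|², where C(T) = (π²/8)(T² − 1)/T³ for 1 < T ≤ 2 and C(T) = π²/64 for T ≥ 2. -/
open MeasureTheory intervalIntegral

/-- The compactly supported kernel whose Fourier transform is positive only on `[-T/2, T/2]`;
it is `π²T² H * H + (deriv H) * (deriv H)`, with convolution products, for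
`H = 1_{[-1/2,1/2]} cos(π·)`. -/
noncomputable def inghamKernel (T s : ℝ) : ℝ :=
  Real.pi ^ 2 / 2 * ((T ^ 2 - 1) * ((1 - min |s| 1) * Real.cos (Real.pi * min |s| 1)) +
    (T ^ 2 + 1) / Real.pi * Real.sin (Real.pi * min |s| 1))

lemma continuous_inghamKernel (T : ℝ) : Continuous (inghamKernel T) := by
  unfold inghamKernel; fun_prop

lemma inghamKernel_zero (T : ℝ) : inghamKernel T 0 = Real.pi ^ 2 / 2 * (T ^ 2 - 1) := by
  simp [inghamKernel]

lemma inghamKernel_neg (T s : ℝ) : inghamKernel T (-s) = inghamKernel T s := by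
  simp [inghamKernel]

lemma inghamKernel_eq_zero (T : ℝ) {s : ℝ} (hs : 1 ≤ |s|) : inghamKernel T s = 0 := by
  simp [inghamKernel, min_eq_right hs]

lemma integrable_inghamKernel (T : ℝ) : Integrable (fun s => (inghamKernel T s : ℂ)) := by
  refine Continuous.integrable_of_hasCompactSupport
    (Complex.continuous_ofReal.comp (continuous_inghamKernel T)) ?_
  refine HasCompactSupport.intro (isCompact_Icc (a := (-1 : ℝ)) (b := 1)) fun s hs => ?_
  rw [inghamKernel_eq_zero T, Complex.ofReal_zero]
  by_contra! h
  exact hs (abs_le.1 h.le)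

lemma integral_cos_mul_cos {y : ℝ} (hy : Real.pi ^ 2 - y ^ 2 ≠ 0) :
    ∫ s in (-(1 / 2 : ℝ))..(1 / 2), Real.cos (Real.pi * s) * Real.cos (y * s) =
      2 * Real.pi * Real.cos (y / 2) / (Real.pi ^ 2 - y ^ 2) := by
  have hd : ∀ s : ℝ, HasDerivAt (fun s : ℝ => (Real.pi * (Real.sin (Real.pi * s) *
      Real.cos (y * s)) - y * (Real.cos (Real.pi * s) * Real.sin (y * s))) /
        (Real.pi ^ 2 - y ^ 2)) (Real.cos (Real.pi * s) * Real.cos (y * s)) s := by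
    intro s
    have hp : HasDerivAt (fun s : ℝ => Real.pi * s) Real.pi s := by
      simpa using (hasDerivAt_id s).const_mul Real.pi
    have hq : HasDerivAt (fun s : ℝ => y * s) y s := by
      simpa using (hasDerivAt_id s).const_mul y
    convert! ((((hp.sin.mul hq.cos).const_mul Real.pi).sub
      ((hp.cos.mul hq.sin).const_mul y)).div_const (Real.pi ^ 2 - y ^ 2)) using 1
    field_simp
    ring
  rw [integral_eq_sub_of_hasDerivAt (fun s _ => hd s)
    (Continuous.intervalIntegrable (by fun_prop) _ _)]
  have e1 : Real.pi * (1 / 2) = Real.pi / 2 := by ring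
  have e2 : y * (1 / 2) = y / 2 := by ring
  simp only [mul_neg, e1, e2, Real.sin_neg, Real.cos_neg, Real.sin_pi_div_two, Real.cos_pi_div_two]
  ring

/-- The Fourier transform of `1_{[-1/2,1/2]} cos(π·)` is maximal at the origin. -/
lemma pi_sq_mul_abs_cos_half_le (y : ℝ) :
    Real.pi ^ 2 * |Real.cos (y / 2)| ≤ |Real.pi ^ 2 - y ^ 2| := by
  have hpi := Real.pi_pos
  by_cases hy : Real.pi ^ 2 - y ^ 2 = 0
  · have : y = Real.pi ∨ y = -Real.pi := sq_eq_sq_iff_eq_or_eq_neg.1 (by linarith)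
    rcases this with rfl | rfl <;> simp [neg_div]
  have h0 := integral_cos_mul_cos (y := 0) (by norm_num)
  have h1 : |∫ s in (-(1 / 2 : ℝ))..(1 / 2), Real.cos (Real.pi * s) * Real.cos (y * s)| ≤
      ∫ s in (-(1 / 2 : ℝ))..(1 / 2), Real.cos (Real.pi * s) * Real.cos (0 * s) := by
    refine (abs_integral_le_integral_abs (by norm_num)).trans ?_
    refine integral_mono_on (by norm_num) (Continuous.intervalIntegrable (by fun_prop) _ _)
      (Continuous.intervalIntegrable (by fun_prop) _ _) fun s hs => ?_
    have : 0 ≤ Real.cos (Real.pi * s) :=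
      Real.cos_nonneg_of_mem_Icc ⟨by nlinarith [hs.1], by nlinarith [hs.2]⟩
    rw [abs_mul, abs_of_nonneg this]
    simpa using mul_le_of_le_one_right this (Real.abs_cos_le_one _)
  rw [integral_cos_mul_cos hy, h0, abs_div, div_le_iff₀ (abs_pos.2 hy), abs_mul,
    abs_of_pos (by positivity : 0 < 2 * Real.pi)] at h1
  simp only [zero_div, Real.cos_zero] at h1
  have h2 : 2 * Real.pi * 1 / (Real.pi ^ 2 - 0 ^ 2) * |Real.pi ^ 2 - y ^ 2| =
    2 / Real.pi * |Real.pi ^ 2 - y ^ 2| := by field_simp; ring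
  rw [h2, div_mul_eq_mul_div, le_div_iff₀ hpi] at h1
  nlinarith

lemma integral_inghamKernel_mul_cos (T : ℝ) {y : ℝ} (hy : Real.pi ^ 2 - y ^ 2 ≠ 0) :
    2 * ∫ s in (0 : ℝ)..1, inghamKernel T s * Real.cos (y * s) =
      4 * Real.pi ^ 2 * Real.cos (y / 2) ^ 2 * (Real.pi ^ 2 * T ^ 2 - y ^ 2) /
        (Real.pi ^ 2 - y ^ 2) ^ 2 := by
  have hpi := Real.pi_ne_zero
  set D := Real.pi ^ 2 - y ^ 2 with hD
  have hd : ∀ s : ℝ, HasDerivAt (fun s : ℝ =>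
      Real.pi ^ 2 / 2 * ((T ^ 2 - 1) * ((1 - s) * ((Real.pi * (Real.sin (Real.pi * s) *
        Real.cos (y * s)) - y * (Real.cos (Real.pi * s) * Real.sin (y * s))) / D) +
        (-(Real.pi ^ 2 + y ^ 2) * (Real.cos (Real.pi * s) * Real.cos (y * s)) -
          2 * Real.pi * y * (Real.sin (Real.pi * s) * Real.sin (y * s))) / D ^ 2) +
        (T ^ 2 + 1) / Real.pi * ((-Real.pi * (Real.cos (Real.pi * s) * Real.cos (y * s)) -
          y * (Real.sin (Real.pi * s) * Real.sin (y * s))) / D)))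
      (Real.pi ^ 2 / 2 * ((T ^ 2 - 1) * ((1 - s) * Real.cos (Real.pi * s)) +
        (T ^ 2 + 1) / Real.pi * Real.sin (Real.pi * s)) * Real.cos (y * s)) s := by
    intro s
    have hp : HasDerivAt (fun s : ℝ => Real.pi * s) Real.pi s := by
      simpa using (hasDerivAt_id s).const_mul Real.pi
    have hq : HasDerivAt (fun s : ℝ => y * s) y s := by
      simpa using (hasDerivAt_id s).const_mul y
    have hr : HasDerivAt (fun s : ℝ => 1 - s) (-1) s := by
      simpa using (hasDerivAt_id s).const_sub 1
    have hcc := hp.cos.mul hq.cos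
    have hss := hp.sin.mul hq.sin
    have hsc := hp.sin.mul hq.cos
    have hcs := hp.cos.mul hq.sin
    convert! (((hr.mul (((hsc.const_mul Real.pi).sub (hcs.const_mul y)).div_const D)).add
      (((hcc.const_mul (-(Real.pi ^ 2 + y ^ 2))).sub
        (hss.const_mul (2 * Real.pi * y))).div_const (D ^ 2))).const_mul (T ^ 2 - 1) |>.add
      ((((hcc.const_mul (-Real.pi)).sub (hss.const_mul y)).div_const D).const_mul
        ((T ^ 2 + 1) / Real.pi))).const_mul (Real.pi ^ 2 / 2) using 1
    simp only [Pi.mul_apply, Pi.sub_apply]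
    field_simp
    rw [hD]
    ring
  have hcongr : ∫ s in (0 : ℝ)..1, inghamKernel T s * Real.cos (y * s) =
      ∫ s in (0 : ℝ)..1, Real.pi ^ 2 / 2 * ((T ^ 2 - 1) * ((1 - s) * Real.cos (Real.pi * s)) +
        (T ^ 2 + 1) / Real.pi * Real.sin (Real.pi * s)) * Real.cos (y * s) := by
    refine integral_congr fun s hs => ?_
    rw [Set.uIcc_of_le zero_le_one] at hs
    simp only [inghamKernel, abs_of_nonneg hs.1, min_eq_left hs.2]
  rw [hcongr, integral_eq_sub_of_hasDerivAt (fun s _ => hd s)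
    (Continuous.intervalIntegrable (by fun_prop) _ _)]
  rw [Real.cos_sq, show 2 * (y / 2) = y by ring]
  simp only [mul_one, mul_zero, Real.sin_pi, Real.cos_pi, Real.sin_zero, Real.cos_zero]
  field_simp
  rw [hD]
  ring

/-- The Fourier transform of `inghamKernel T`, as a real cosine integral. -/
noncomputable def inghamWeight (T x : ℝ) : ℝ :=
  2 * ∫ s in (0 : ℝ)..1, inghamKernel T s * Real.cos (2 * Real.pi * x * s)

lemma continuous_inghamWeight (T : ℝ) : Continuous (inghamWeight T) := by
  have := continuous_inghamKernel T
  refine continuous_const.mul ?_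
  exact intervalIntegral.continuous_parametric_intervalIntegral_of_continuous'
    (f := fun x s => inghamKernel T s * Real.cos (2 * Real.pi * x * s)) (by fun_prop) 0 1

open FourierTransform in
lemma fourier_inghamKernel (T : ℝ) :
    𝓕 (fun s => (inghamKernel T s : ℂ)) = fun x => (inghamWeight T x : ℂ) := by
  ext x
  have hc : Continuous fun s => (inghamKernel T s : ℂ) :=
    Complex.continuous_ofReal.comp (continuous_inghamKernel T)
  rw [Real.fourier_real_eq_integral_exp_smul,
    ← integral_eq_integral_of_support_subset (a := -1) (b := 1),
    ← integral_add_adjacent_intervals (b := 0)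
      (Continuous.intervalIntegrable (by fun_prop) _ _)
      (Continuous.intervalIntegrable (by fun_prop) _ _)]
  · have hneg := integral_comp_neg (a := 0) (b := 1) fun v : ℝ =>
      Complex.exp (↑(-2 * Real.pi * v * x) * Complex.I) • (inghamKernel T v : ℂ)
    rw [neg_zero] at hneg
    rw [← hneg, ← intervalIntegral.integral_add
      (Continuous.intervalIntegrable (by simp only [inghamKernel_neg]; fun_prop) _ _)
      (Continuous.intervalIntegrable (by fun_prop) _ _), inghamWeight,
      ← intervalIntegral.integral_const_mul, ← intervalIntegral.integral_ofReal]
    refine integral_congr fun s _ => ?_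
    simp only [inghamKernel_neg, smul_eq_mul]
    push_cast
    rw [Complex.cos]
    ring_nf
  · intro s hs
    by_contra h
    refine hs ?_
    beta_reduce
    rw [inghamKernel_eq_zero, Complex.ofReal_zero, smul_zero]
    by_contra! hlt
    exact h ⟨(abs_lt.1 hlt).1, (abs_lt.1 hlt).2.le⟩

lemma ae_pi_sq_sub_ne_zero :
    ∀ᵐ x : ℝ, Real.pi ^ 2 - (2 * Real.pi * x) ^ 2 ≠ 0 := by
  have : ({1 / 2, -(1 / 2)} : Set ℝ)ᶜ ∈ ae (volume : Measure ℝ) :=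
    compl_mem_ae_iff.2 ((Set.toFinite _).measure_zero _)
  filter_upwards [this] with x hx h
  refine hx ?_
  have h1 : Real.pi ^ 2 * ((1 / 2) ^ 2 - x ^ 2) = 0 := by linear_combination h / 4
  have h2 : x ^ 2 = (1 / 2) ^ 2 := by
    have := (mul_eq_zero.1 h1).resolve_left (by positivity)
    linarith
  simpa using sq_eq_sq_iff_eq_or_eq_neg.1 h2

lemma inghamWeight_eq (T : ℝ) {x : ℝ} (hx : Real.pi ^ 2 - (2 * Real.pi * x) ^ 2 ≠ 0) :
    inghamWeight T x = 4 * Real.pi ^ 2 * Real.cos (Real.pi * x) ^ 2 *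
      (Real.pi ^ 2 * T ^ 2 - (2 * Real.pi * x) ^ 2) /
        (Real.pi ^ 2 - (2 * Real.pi * x) ^ 2) ^ 2 := by
  rw [inghamWeight, integral_inghamKernel_mul_cos T hx,
    show 2 * Real.pi * x / 2 = Real.pi * x by ring]

lemma pi_pow_four_mul_cos_sq_le (x : ℝ) :
    Real.pi ^ 4 * Real.cos (Real.pi * x) ^ 2 ≤ (Real.pi ^ 2 - (2 * Real.pi * x) ^ 2) ^ 2 := by
  have h := pi_sq_mul_abs_cos_half_le (2 * Real.pi * x)
  have := pow_le_pow_left₀ (by positivity) h 2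
  rwa [sq_abs, mul_pow, sq_abs, ← pow_mul,
    show 2 * Real.pi * x / 2 = Real.pi * x by ring] at this

lemma inghamWeight_le {T x : ℝ} (hx : Real.pi ^ 2 - (2 * Real.pi * x) ^ 2 ≠ 0) :
    inghamWeight T x ≤ 4 * T ^ 2 := by
  rw [inghamWeight_eq T hx, div_le_iff₀ (by positivity)]
  have h := mul_le_mul_of_nonneg_left (pi_pow_four_mul_cos_sq_le x)
    (by positivity : 0 ≤ 4 * T ^ 2)
  have : 0 ≤ 4 * Real.pi ^ 2 * Real.cos (Real.pi * x) ^ 2 * (2 * Real.pi * x) ^ 2 := by positivity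
  linarith

lemma inghamWeight_nonpos {T x : ℝ} (hT : 0 ≤ T) (hTx : T / 2 ≤ |x|)
    (hx : Real.pi ^ 2 - (2 * Real.pi * x) ^ 2 ≠ 0) : inghamWeight T x ≤ 0 := by
  rw [inghamWeight_eq T hx]
  refine div_nonpos_of_nonpos_of_nonneg (mul_nonpos_of_nonneg_of_nonpos (by positivity) ?_)
    (by positivity)
  have h : T ^ 2 ≤ (2 * |x|) ^ 2 := by gcongr; linarith
  rw [mul_pow, sq_abs] at h
  nlinarith [mul_le_mul_of_nonneg_left h (sq_nonneg Real.pi)]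

lemma abs_inghamWeight_le {T x : ℝ} (hT : 1 ≤ T)
    (hx : Real.pi ^ 2 - (2 * Real.pi * x) ^ 2 ≠ 0) :
    |inghamWeight T x| ≤ 400 * T ^ 2 * (1 + x ^ 2)⁻¹ := by
  have hT2 : 1 ≤ T ^ 2 := one_le_pow₀ hT
  have hcos : Real.pi ^ 4 * (1 + x ^ 2) ^ 2 * Real.cos (Real.pi * x) ^ 2 ≤
      25 * (Real.pi ^ 2 - (2 * Real.pi * x) ^ 2) ^ 2 := by
    rcases le_total (x ^ 2) 1 with h | h
    · have h1 : (1 + x ^ 2) ^ 2 ≤ 25 := by nlinarith [sq_nonneg x]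
      have := mul_le_mul h1 (pi_pow_four_mul_cos_sq_le x) (by positivity) (by norm_num)
      linarith
    · have h1 : (1 + x ^ 2) ^ 2 ≤ (4 * x ^ 2 - 1) ^ 2 :=
        pow_le_pow_left₀ (by positivity) (by linarith) 2
      have h2 : Real.pi ^ 4 * (1 + x ^ 2) ^ 2 * Real.cos (Real.pi * x) ^ 2 ≤
          Real.pi ^ 4 * (1 + x ^ 2) ^ 2 :=
        mul_le_of_le_one_right (by positivity) (Real.cos_sq_le_one _)
      have h3 := mul_le_mul_of_nonneg_left h1 (by positivity : 0 ≤ Real.pi ^ 4)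
      nlinarith [sq_nonneg (Real.pi ^ 2 - (2 * Real.pi * x) ^ 2)]
  have hnum : |Real.pi ^ 2 * T ^ 2 - (2 * Real.pi * x) ^ 2| ≤
      Real.pi ^ 2 * (4 * T ^ 2 * (1 + x ^ 2)) := by
    rw [abs_le]
    have h1 : 0 ≤ Real.pi ^ 2 * (T ^ 2 - 1) * x ^ 2 :=
      mul_nonneg (mul_nonneg (by positivity) (by linarith)) (by positivity)
    have h2 : 0 ≤ Real.pi ^ 2 * T ^ 2 := by positivity
    have h3 : 0 ≤ Real.pi ^ 2 * x ^ 2 := by positivity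
    have h4 : 0 ≤ Real.pi ^ 2 * T ^ 2 * x ^ 2 := by positivity
    constructor <;> nlinarith
  rw [inghamWeight_eq T hx, ← div_eq_mul_inv, abs_div, abs_mul,
    abs_of_nonneg (by positivity : 0 ≤ 4 * Real.pi ^ 2 * Real.cos (Real.pi * x) ^ 2),
    abs_of_nonneg (by positivity : 0 ≤ (Real.pi ^ 2 - (2 * Real.pi * x) ^ 2) ^ 2),
    div_le_div_iff₀ (by positivity) (by positivity)]
  calc 4 * Real.pi ^ 2 * Real.cos (Real.pi * x) ^ 2 *
        |Real.pi ^ 2 * T ^ 2 - (2 * Real.pi * x) ^ 2| * (1 + x ^ 2)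
      ≤ 4 * Real.pi ^ 2 * Real.cos (Real.pi * x) ^ 2 *
        (Real.pi ^ 2 * (4 * T ^ 2 * (1 + x ^ 2))) * (1 + x ^ 2) := by gcongr
    _ = 16 * T ^ 2 * (Real.pi ^ 4 * (1 + x ^ 2) ^ 2 * Real.cos (Real.pi * x) ^ 2) := by ring
    _ ≤ 16 * T ^ 2 * (25 * (Real.pi ^ 2 - (2 * Real.pi * x) ^ 2) ^ 2) := by gcongr
    _ = _ := by ring

lemma integrable_inghamWeight {T : ℝ} (hT : 1 ≤ T) : Integrable (inghamWeight T) := by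
  refine (integrable_inv_one_add_sq.const_mul (400 * T ^ 2)).mono'
    (continuous_inghamWeight T).aestronglyMeasurable ?_
  filter_upwards [ae_pi_sq_sub_ne_zero] with x hx using abs_inghamWeight_le hT hx

lemma integral_inghamWeight_mul_exp {T : ℝ} (hT : 1 ≤ T) (x : ℝ) :
    ∫ t : ℝ, (inghamWeight T t : ℂ) * Complex.exp (((2 * Real.pi * x * t : ℝ) : ℂ) * Complex.I) =
      inghamKernel T x := by
  have h := Continuous.fourierInv_fourier_eq
    (Complex.continuous_ofReal.comp (continuous_inghamKernel T)) (integrable_inghamKernel T)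
    (by
      have h := fourier_inghamKernel T
      simp only [Function.comp_def]
      rw [h]
      exact (integrable_inghamWeight hT).ofReal)
  have h' := congrFun h x
  simp only [Function.comp_def] at h'
  rw [fourier_inghamKernel, Real.fourierInv_eq'] at h'
  rw [← h']
  refine integral_congr_ae (.of_forall fun t => ?_)
  simp only [smul_eq_mul, RCLike.inner_apply, conj_trivial]
  rw [mul_comm]
  congr 4
  ring

/-- The trigonometric sum with real frequencies `lam` and coefficients `a`. -/
noncomputable def trigSum {ι : Type*} [Fintype ι] (lam : ι → ℝ) (a : ι → ℂ) (t : ℝ) : ℂ :=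
  ∑ k, a k * Complex.exp (((2 * Real.pi * lam k * t : ℝ) : ℂ) * Complex.I)

section trigSum

variable {ι : Type*} [Fintype ι] (lam : ι → ℝ) (a : ι → ℂ)

lemma continuous_trigSum : Continuous (trigSum lam a) := by
  unfold trigSum; fun_prop

lemma norm_trigSum_le (t : ℝ) : ‖trigSum lam a t‖ ≤ ∑ k, ‖a k‖ := by
  refine (norm_sum_le _ _).trans_eq (Finset.sum_congr rfl fun k _ => ?_)
  rw [norm_mul, Complex.norm_exp_ofReal_mul_I, mul_one]

lemma norm_trigSum_sq (t : ℝ) :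
    ((‖trigSum lam a t‖ ^ 2 : ℝ) : ℂ) = ∑ k, ∑ l, a k * star (a l) *
      Complex.exp (((2 * Real.pi * (lam k - lam l) * t : ℝ) : ℂ) * Complex.I) := by
  have h := Complex.mul_conj' (trigSum lam a t)
  rw [Complex.ofReal_pow, ← h, trigSum, map_sum, Finset.sum_mul_sum]
  refine Finset.sum_congr rfl fun k _ => Finset.sum_congr rfl fun l _ => ?_
  rw [map_mul, ← Complex.exp_conj, map_mul, Complex.conj_I, Complex.conj_ofReal,
    mul_mul_mul_comm, ← Complex.exp_add]
  congr 2
  push_cast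
  ring

lemma integrable_inghamWeight_mul_trigSum {T : ℝ} (hT : 1 ≤ T) :
    Integrable fun t => inghamWeight T t * ‖trigSum lam a t‖ ^ 2 := by
  have hc := continuous_trigSum lam a
  refine (integrable_inghamWeight hT).mul_bdd (c := (∑ k, ‖a k‖) ^ 2)
    (Continuous.aestronglyMeasurable (by fun_prop)) (.of_forall fun t => ?_)
  rw [Real.norm_of_nonneg (by positivity)]
  gcongr
  exact norm_trigSum_le lam a t

variable {lam}

lemma integral_inghamWeight_mul_trigSum (hsep : ∀ k l, k ≠ l → 1 ≤ |lam k - lam l|)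
    {T : ℝ} (hT : 1 ≤ T) :
    ∫ t, inghamWeight T t * ‖trigSum lam a t‖ ^ 2 =
      Real.pi ^ 2 / 2 * (T ^ 2 - 1) * ∑ k, ‖a k‖ ^ 2 := by
  have hInt (k l : ι) : Integrable fun t : ℝ => a k * star (a l) * ((inghamWeight T t : ℂ) *
      Complex.exp (((2 * Real.pi * (lam k - lam l) * t : ℝ) : ℂ) * Complex.I)) := by
    refine Integrable.const_mul ?_ _
    refine (integrable_inghamWeight hT).ofReal.mul_bdd (c := 1)
      (Continuous.aestronglyMeasurable (by fun_prop)) (.of_forall fun t => ?_)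
    rw [Complex.norm_exp_ofReal_mul_I]
  have hexp : ∀ t : ℝ, ((inghamWeight T t * ‖trigSum lam a t‖ ^ 2 : ℝ) : ℂ) =
      ∑ k, ∑ l, a k * star (a l) * ((inghamWeight T t : ℂ) *
        Complex.exp (((2 * Real.pi * (lam k - lam l) * t : ℝ) : ℂ) * Complex.I)) := by
    intro t
    rw [Complex.ofReal_mul, norm_trigSum_sq]
    simp only [Finset.mul_sum]
    refine Finset.sum_congr rfl fun k _ => Finset.sum_congr rfl fun l _ => by ring
  apply Complex.ofReal_injective
  rw [← integral_complex_ofReal]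
  simp only [hexp]
  rw [integral_finsetSum _ fun k _ => integrable_finsetSum _ fun l _ => hInt k l]
  rw [Finset.mul_sum, Complex.ofReal_sum]
  refine Finset.sum_congr rfl fun k _ => ?_
  rw [integral_finsetSum _ fun l _ => hInt k l, Finset.sum_eq_single k]
  · rw [MeasureTheory.integral_const_mul, integral_inghamWeight_mul_exp hT, sub_self,
      inghamKernel_zero, Complex.star_def, Complex.mul_conj']
    push_cast
    ring
  · intro l _ hl
    rw [MeasureTheory.integral_const_mul, integral_inghamWeight_mul_exp hT,
      inghamKernel_eq_zero T (hsep k l hl.symm), Complex.ofReal_zero, mul_zero]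
  · simp

/-- Ingham's inequality on a centred interval, with the constant given by `inghamKernel`. -/
lemma le_integral_norm_trigSum_sq (hsep : ∀ k l, k ≠ l → 1 ≤ |lam k - lam l|)
    {T : ℝ} (hT : 1 ≤ T) :
    Real.pi ^ 2 / 8 * (T ^ 2 - 1) / T ^ 2 * ∑ k, ‖a k‖ ^ 2 ≤
      ∫ t in (-(T / 2))..(T / 2), ‖trigSum lam a t‖ ^ 2 := by
  have hc := continuous_trigSum lam a
  have hle : ∫ t, inghamWeight T t * ‖trigSum lam a t‖ ^ 2 ≤
      ∫ t, (Set.Ioc (-(T / 2)) (T / 2)).indicator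
        (fun t => 4 * T ^ 2 * ‖trigSum lam a t‖ ^ 2) t := by
    refine integral_mono_ae (integrable_inghamWeight_mul_trigSum lam a hT) ?_ ?_
    · rw [integrable_indicator_iff measurableSet_Ioc]
      exact (Continuous.integrableOn_Icc (by fun_prop)).mono_set Set.Ioc_subset_Icc_self
    · filter_upwards [ae_pi_sq_sub_ne_zero] with t ht
      by_cases hm : t ∈ Set.Ioc (-(T / 2)) (T / 2)
      · rw [Set.indicator_of_mem hm]
        exact mul_le_mul_of_nonneg_right (inghamWeight_le ht) (by positivity)
      · rw [Set.indicator_of_notMem hm]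
        refine mul_nonpos_of_nonpos_of_nonneg (inghamWeight_nonpos (by linarith) ?_ ht)
          (by positivity)
        by_contra! h
        exact hm ⟨(abs_lt.1 h).1, (abs_lt.1 h).2.le⟩
  rw [integral_inghamWeight_mul_trigSum a hsep hT, MeasureTheory.integral_indicator
    measurableSet_Ioc, ← integral_of_le (by linarith), intervalIntegral.integral_const_mul] at hle
  rw [div_mul_eq_mul_div, div_le_iff₀ (by positivity)]
  linarith

lemma le_integral_norm_trigSum_sq_of_center (hsep : ∀ k l, k ≠ l → 1 ≤ |lam k - lam l|)
    {T : ℝ} (hT : 1 ≤ T) (c : ℝ) :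
    Real.pi ^ 2 / 8 * (T ^ 2 - 1) / T ^ 2 * ∑ k, ‖a k‖ ^ 2 ≤
      ∫ t in (c - T / 2)..(c + T / 2), ‖trigSum lam a t‖ ^ 2 := by
  have h := le_integral_norm_trigSum_sq
    (fun k => a k * Complex.exp (((2 * Real.pi * lam k * c : ℝ) : ℂ) * Complex.I)) hsep hT
  have hshift : ∀ t, trigSum lam (fun k => a k *
      Complex.exp (((2 * Real.pi * lam k * c : ℝ) : ℂ) * Complex.I)) t = trigSum lam a (t + c) := by
    intro t
    refine Finset.sum_congr rfl fun k _ => ?_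
    rw [mul_assoc, ← Complex.exp_add]
    congr 2
    push_cast
    ring
  simp only [norm_mul, Complex.norm_exp_ofReal_mul_I, mul_one, hshift] at h
  rwa [integral_comp_add_right (fun t => ‖trigSum lam a t‖ ^ 2), neg_add_eq_sub, add_comm _ c] at h

lemma le_integral_norm_trigSum_sq_of_two_le (hsep : ∀ k l, k ≠ l → 1 ≤ |lam k - lam l|)
    {T : ℝ} (hT : 2 ≤ T) :
    T * (Real.pi ^ 2 / 64) * ∑ k, ‖a k‖ ^ 2 ≤
      ∫ t in (-(T / 2))..(T / 2), ‖trigSum lam a t‖ ^ 2 := by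
  have hc := continuous_trigSum lam a
  have hInt (u v : ℝ) : IntervalIntegrable (fun t => ‖trigSum lam a t‖ ^ 2) volume u v :=
    Continuous.intervalIntegrable (by fun_prop) _ _
  set S := ∑ k, ‖a k‖ ^ 2
  have hS : 0 ≤ Real.pi ^ 2 * S := by positivity
  set n := ⌊T / 2⌋₊
  have hn : (n : ℝ) ≤ T / 2 := Nat.floor_le (by linarith)
  have hn' : T / 4 ≤ n := by
    have h1 : (1 : ℝ) ≤ n := by exact_mod_cast Nat.le_floor (by norm_num; linarith)
    have h2 : T / 2 < n + 1 := Nat.lt_floor_add_one _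
    linarith
  have hblock : ∀ j ∈ Finset.range n, 3 * Real.pi ^ 2 / 32 * S ≤
      ∫ t in (-(T / 2) + 2 * (j : ℝ))..(-(T / 2) + 2 * ((j + 1 : ℕ) : ℝ)),
        ‖trigSum lam a t‖ ^ 2 := by
    intro j _
    have h := le_integral_norm_trigSum_sq_of_center a hsep one_le_two (-(T / 2) + 2 * j + 1)
    convert h using 2
    · ring
    · ring
    · push_cast; ring
  have hsum := Finset.sum_le_sum hblock
  rw [sum_integral_adjacent_intervals (a := fun j : ℕ => -(T / 2) + 2 * (j : ℝ))
    fun k _ => hInt _ _, Finset.sum_const, Finset.card_range, nsmul_eq_mul] at hsum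
  simp only [Nat.cast_zero, mul_zero, add_zero] at hsum
  have hmono : ∫ t in (-(T / 2))..(-(T / 2) + 2 * (n : ℝ)), ‖trigSum lam a t‖ ^ 2 ≤
      ∫ t in (-(T / 2))..(T / 2), ‖trigSum lam a t‖ ^ 2 :=
    integral_mono_interval le_rfl (by linarith [n.cast_nonneg (α := ℝ)]) (by linarith)
      (.of_forall fun t => by positivity) (hInt _ _)
  nlinarith [mul_le_mul_of_nonneg_right hn' hS]

end trigSum

/-- Ingham's L² inequality for 1-separated real frequencies on an interval of
length `T > 1`, with `C(T) = (π²/8)(T²-1)/T³` for `1 < T ≤ 2` and `C(T) = π²/64`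
for `T ≥ 2`. -/
theorem ingham_L2 (N : ℕ) (lam : Fin N → ℝ)
    (hsep : ∀ k l : Fin N, k ≠ l → 1 ≤ |lam k - lam l|)
    (a : Fin N → ℂ) (T : ℝ) (hT : 1 < T) :
    T * (if T ≤ 2 then Real.pi ^ 2 / 8 * (T ^ 2 - 1) / T ^ 3 else Real.pi ^ 2 / 64) *
        ∑ k : Fin N, ‖a k‖ ^ 2 ≤
      ∫ t in (-(T/2))..(T/2),
        ‖∑ k : Fin N, a k * Complex.exp (((2 * Real.pi * lam k * t : ℝ) : ℂ) * Complex.I)‖ ^ 2 := by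
  change _ ≤ ∫ t in (-(T/2))..(T/2), ‖trigSum lam a t‖ ^ 2
  split_ifs with h
  · convert le_integral_norm_trigSum_sq a hsep hT.le using 2
    field_simp
  · exact le_integral_norm_trigSum_sq_of_two_le a hsep (not_le.1 h).le
end
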